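/- Let f ∈ ℤ[X] be of degree d ≥ 2 belonging to class 𝒫₁, i.e. its derivative has the form f'(X) = g(X)²(aX+b) with g ∈ ℤ[X], a,b ∈ ℤ, a ≠ 0, and set γ = -b/a. Assume γ is not a pre-periodic point of f. Then there exist a constant C > 0 and Q₀ (both depending only on f) such that for all Q ≥ Q₀ one has P_f(Q) ≤ C · Q / (log Q · log log log Q). -/

import Mathlib

open Polynomial

/-- The `n`-th iterate of a polynomial: `f^(0) = X`, `f^(n) = f(f^(n-1))`. -/
noncomputable def polyIter {R : Type*} [CommSemiring R] (f : R[X]) : ℕ → R[X]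
  | 0 => X
  | n + 1 => f.comp (polyIter f n)

/-- A polynomial is dynamically irreducible if all its iterates `f^(n)`, `n ≥ 1`,
are irreducible. -/
def DynIrred {R : Type*} [CommSemiring R] (f : R[X]) : Prop :=
  ∀ n : ℕ, 1 ≤ n → Irreducible (polyIter f n)

/-- `γ ∈ ℚ` is pre-periodic for `f ∈ ℤ[X]` if its forward orbit `{f^(n)(γ) : n ≥ 1}`
is finite. -/
def IsPreperiodicPt (f : ℤ[X]) (γ : ℚ) : Prop :=
  {x : ℚ | ∃ n : ℕ, 1 ≤ n ∧ x = Polynomial.aeval γ (polyIter f n)}.Finite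

/-- `P_f(Q)`: the number of primes `p ∈ [Q, 2Q]` such that the reduction of `f` mod `p`
is dynamically irreducible over `𝔽_p`. -/
noncomputable def Pf (f : ℤ[X]) (Q : ℕ) : ℕ :=
  {p : ℕ | p.Prime ∧ Q ≤ p ∧ p ≤ 2 * Q ∧
    DynIrred (f.map (Int.castRingHom (ZMod p)))}.ncard

open scoped NumberTheorySymbols

lemma jacobiSym_eq_one_of_modEq {m r : ℕ} (hr : Odd r) (h : r ≡ 1 [MOD 4 * m]) :
    J((m : ℤ) | r) = 1 := by
  rw [jacobiSym.mod_right' m hr, h, ← jacobiSym.mod_right' m odd_one, jacobiSym.one_right]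

lemma exists_jacobiSym_eq_neg_one_of_odd_prime {ℓ m k : ℕ} (hℓ : ℓ.Prime) (h2 : ℓ ≠ 2)
    (hk : Odd k) (hm : ¬ ℓ ∣ m) (ε : ℤ) (hε : ε = 1 ∨ ε = -1) :
    ∃ r : ℕ, Odd r ∧ J(ε * (ℓ ^ k * m : ℕ) | r) = -1 := by
  have := Fact.mk hℓ
  obtain ⟨ν, hν⟩ := FiniteField.exists_nonsquare (F := ZMod ℓ) (by rwa [ZMod.ringChar_zmod_n])
  have hodd : Odd ℓ := hℓ.odd_of_ne_two h2
  have hcop : Nat.Coprime (4 * m) ℓ := by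
    refine Nat.Coprime.mul_left ?_ ((Nat.coprime_comm).1 ((Nat.Prime.coprime_iff_not_dvd hℓ).2 hm))
    have : Nat.Coprime 2 ℓ := (Nat.coprime_primes Nat.prime_two hℓ).2 (Ne.symm h2)
    exact Nat.Coprime.pow_left 2 this
  obtain ⟨r, hr1, hr2⟩ := Nat.chineseRemainder hcop 1 ν.val
  have hr4 : r % 4 = 1 := Nat.ModEq.of_dvd (Dvd.intro m rfl) hr1
  have hro : Odd r := Nat.odd_iff.2 (by omega)
  refine ⟨r, hro, ?_⟩
  have e1 : J(ε | r) = 1 := by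
    rcases hε with rfl | rfl
    · exact jacobiSym.one_left r
    · rw [jacobiSym.at_neg_one hro, ZMod.χ₄_nat_one_mod_four hr4]
  have e2 : J((ℓ : ℤ) | r) = -1 := by
    rw [jacobiSym.quadratic_reciprocity_one_mod_four' hodd hr4,
      ZMod.nonsquare_iff_jacobiSym_eq_neg_one]
    have : ((r : ℤ) : ZMod ℓ) = ν := by
      rw [Int.cast_natCast, (ZMod.natCast_eq_natCast_iff _ _ _).2 hr2, ZMod.natCast_zmod_val]
    rwa [this]
  push_cast
  rw [jacobiSym.mul_left, jacobiSym.mul_left, jacobiSym.pow_left, e1, e2,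
    jacobiSym_eq_one_of_modEq hro hr1, hk.neg_one_pow]
  norm_num

lemma exists_jacobiSym_eq_neg_one {w : ℤ} (hw : ¬ IsSquare w) :
    ∃ r : ℕ, Odd r ∧ J(w | r) = -1 := by
  have hw0 : w ≠ 0 := by rintro rfl; exact hw ⟨0, by simp⟩
  obtain ⟨a, b, hab, hsq⟩ := Nat.sq_mul_squarefree w.natAbs
  have hb0 : b ≠ 0 := by
    rintro rfl
    exact hw0 (Int.natAbs_eq_zero.1 (by simpa using hab.symm))
  have ha0 : a ≠ 0 := hsq.ne_zero
  obtain ⟨ε, hε, hwε⟩ : ∃ ε : ℤ, (ε = 1 ∨ ε = -1) ∧ w = ε * (b ^ 2 * a : ℕ) := by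
    rcases Int.natAbs_eq w with h | h
    · exact ⟨1, Or.inl rfl, by rw [hab, one_mul]; exact h⟩
    · exact ⟨-1, Or.inr rfl, by rw [hab, neg_one_mul]; exact h⟩
  by_cases hodd : ∃ ℓ : ℕ, ℓ.Prime ∧ ℓ ≠ 2 ∧ ℓ ∣ a
  · obtain ⟨ℓ, hℓ, h2, a', rfl⟩ := hodd
    obtain ⟨i, b', hb', rfl⟩ := Nat.exists_eq_pow_mul_and_not_dvd hb0 ℓ hℓ.ne_one
    have ha' : ¬ ℓ ∣ a' := by
      intro h
      exact hℓ.one_lt.ne' (Nat.isUnit_iff.1 (hsq ℓ (Nat.mul_dvd_mul_left ℓ h)))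
    obtain ⟨r, hr, h⟩ := exists_jacobiSym_eq_neg_one_of_odd_prime (k := 2 * i + 1)
      (m := b' ^ 2 * a') hℓ h2 ⟨i, rfl⟩
      (fun h => (hℓ.dvd_mul.1 h).elim (fun h => hb' (hℓ.dvd_of_dvd_pow h)) ha') ε hε
    refine ⟨r, hr, ?_⟩
    rw [hwε, ← h]
    congr 3
    ring
  · push Not at hodd
    have ha : a = 1 ∨ a = 2 := by
      have hap : a = 2 ^ a.primeFactorsList.length :=
        Nat.eq_prime_pow_of_unique_prime_dvd ha0 (fun {d} hd hda => by
          by_contra h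
          exact hodd d hd h hda)
      generalize a.primeFactorsList.length = n at hap
      rcases n with _ | _ | n
      · left; simpa using hap
      · right; simpa using hap
      · exfalso
        have : 2 * 2 ∣ a := ⟨2 ^ n, by rw [hap]; ring⟩
        have := Nat.isUnit_iff.1 (hsq 2 this)
        omega
    obtain ⟨i, s, hs, rfl⟩ := Nat.exists_eq_pow_mul_and_not_dvd hb0 2 (by norm_num)
    have hcop : Nat.Coprime 8 s :=
      Nat.Coprime.pow_left 3 ((Nat.Prime.coprime_iff_not_dvd Nat.prime_two).2 hs)
    have key : ∀ c : ℕ, (c = 3 ∨ c = 5) → ∃ r : ℕ, r % 8 = c ∧ Odd r ∧ J(w | r) = J(ε * a | r) := by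
      intro c hc
      obtain ⟨r, hr1, hr2⟩ := Nat.chineseRemainder hcop c 1
      have hr8 : r % 8 = c := by
        have : r % 8 = c % 8 := hr1
        rcases hc with rfl | rfl <;> simpa using this
      have hro : Odd r := Nat.odd_iff.2 (by omega)
      refine ⟨r, hr8, hro, ?_⟩
      have hg : Int.gcd ((2 ^ i * s : ℕ) : ℤ) r = 1 := by
        rw [Int.gcd_natCast_natCast]
        refine Nat.Coprime.mul_left ?_ ?_
        · exact Nat.Coprime.pow_left i (Nat.coprime_two_left.2 hro)
        · rw [Nat.coprime_comm, Nat.Coprime, hr2.gcd_eq, Nat.gcd_one_left]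
      have : w = ((2 ^ i * s : ℕ) : ℤ) ^ 2 * (ε * a) := by rw [hwε]; push_cast; ring
      rw [this, jacobiSym.mul_left, jacobiSym.sq_one' hg, one_mul]
    rcases ha with rfl | rfl
    · have : ε = -1 := by
        rcases hε with rfl | rfl
        · exact absurd ⟨((2 ^ i * s : ℕ) : ℤ), by rw [hwε]; push_cast; ring⟩ hw
        · rfl
      subst this
      obtain ⟨r, hr8, hro, h⟩ := key 3 (Or.inl rfl)
      refine ⟨r, hro, ?_⟩
      rw [h, Nat.cast_one, mul_one, jacobiSym.at_neg_one hro,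
        ZMod.χ₄_nat_three_mod_four (by omega)]
    · obtain ⟨r, hr8, hro, h⟩ := key 5 (Or.inr rfl)
      refine ⟨r, hro, ?_⟩
      have h1 : J(ε | r) = 1 := by
        rcases hε with rfl | rfl
        · exact jacobiSym.one_left r
        · rw [jacobiSym.at_neg_one hro, ZMod.χ₄_nat_one_mod_four (by omega)]
      rw [h, jacobiSym.mul_left, h1, Nat.cast_ofNat, jacobiSym.at_two hro,
        ZMod.χ₈_nat_eq_if_mod_eight, if_neg (by omega), if_neg (by omega), one_mul]

/-- The Jacobi symbol `J(w | n)`, extended by zero to even `n`. -/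
def oddJacobi (w : ℤ) (n : ℕ) : ℤ := if Odd n then J(w | n) else 0

lemma oddJacobi_of_odd (w : ℤ) {n : ℕ} (hn : Odd n) : oddJacobi w n = J(w | n) := if_pos hn

lemma oddJacobi_mod (w : ℤ) (n : ℕ) : oddJacobi w (n % (4 * w.natAbs)) = oddJacobi w n := by
  unfold oddJacobi
  have h : Odd (n % (4 * w.natAbs)) ↔ Odd n := by
    rw [Nat.odd_iff, Nat.odd_iff, Nat.mod_mod_of_dvd _ ⟨2 * w.natAbs, by ring⟩]
  by_cases hn : Odd n
  · rw [if_pos hn, if_pos (h.2 hn), ← jacobiSym.mod_right w hn]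
  · rw [if_neg hn, if_neg (mt h.1 hn)]

lemma oddJacobi_mul_right (w : ℤ) (m n : ℕ) :
    oddJacobi w (m * n) = oddJacobi w m * oddJacobi w n := by
  unfold oddJacobi
  by_cases hm : Odd m <;> by_cases hn : Odd n <;> simp [Nat.odd_mul, hm, hn]
  exact jacobiSym.mul_right' w hm.pos.ne' hn.pos.ne'

lemma oddJacobi_mul_left (v w : ℤ) (n : ℕ) :
    oddJacobi (v * w) n = oddJacobi v n * oddJacobi w n := by
  unfold oddJacobi
  split_ifs
  · exact jacobiSym.mul_left v w n
  · simp

lemma abs_oddJacobi_le_one (w : ℤ) (n : ℕ) : |oddJacobi w n| ≤ 1 := by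
  unfold oddJacobi
  split_ifs
  · rcases jacobiSym.trichotomy w n with h | h | h <;> simp [h]
  · simp

lemma sum_range_period_oddJacobi {w : ℤ} (hw : ¬ IsSquare w) :
    ∑ i ∈ Finset.range (4 * w.natAbs), oddJacobi w i = 0 := by
  obtain ⟨r, hr, hJ⟩ := exists_jacobiSym_eq_neg_one hw
  set q := 4 * w.natAbs with hq
  have hq0 : 0 < q := by
    have : w ≠ 0 := by rintro rfl; exact hw ⟨0, by simp⟩
    have := Int.natAbs_pos.2 this
    omega
  have hcop : Nat.Coprime q r := by
    refine Nat.Coprime.mul_left (Nat.Coprime.pow_left 2 (Nat.coprime_two_left.2 hr)) ?_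
    by_contra h
    have : J(w | r) = 0 := jacobiSym.eq_zero_iff.2 ⟨hr.pos.ne', by
      rwa [Int.gcd_eq_natAbs, Int.natAbs_natCast]⟩
    rw [hJ] at this
    norm_num at this
  have hinj : Set.InjOn (fun i => r * i % q) (Finset.range q : Set ℕ) := by
    intro i hi j hj hij
    have : i ≡ j [MOD q] := Nat.ModEq.cancel_left_of_coprime (c := r) hcop hij
    simp only [Finset.coe_range, Set.mem_Iio] at hi hj
    exact Nat.ModEq.eq_of_lt_of_lt this hi hj
  have himg : (Finset.range q).image (fun i => r * i % q) = Finset.range q := by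
    apply Finset.eq_of_subset_of_card_le
    · intro x hx
      obtain ⟨i, -, rfl⟩ := Finset.mem_image.1 hx
      exact Finset.mem_range.2 (Nat.mod_lt _ hq0)
    · rw [Finset.card_image_of_injOn hinj]
  have h : ∑ i ∈ Finset.range q, oddJacobi w i = -∑ i ∈ Finset.range q, oddJacobi w i := by
    conv_lhs => rw [← himg, Finset.sum_image hinj]
    rw [← Finset.sum_neg_distrib]
    refine Finset.sum_congr rfl fun i _ => ?_
    rw [oddJacobi_mod, oddJacobi_mul_right, oddJacobi_of_odd w hr, hJ, neg_one_mul]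
  omega

lemma abs_sum_range_oddJacobi_le {w : ℤ} (hw : ¬ IsSquare w) (n : ℕ) :
    |∑ i ∈ Finset.range n, oddJacobi w i| ≤ 4 * w.natAbs := by
  induction n using Nat.strong_induction_on with
  | _ n ih =>
    by_cases hn : n ≤ 4 * w.natAbs
    · calc |∑ i ∈ Finset.range n, oddJacobi w i| ≤ ∑ i ∈ Finset.range n, |oddJacobi w i| :=
            Finset.abs_sum_le_sum_abs _ _
        _ ≤ ∑ i ∈ Finset.range n, 1 := Finset.sum_le_sum fun i _ => abs_oddJacobi_le_one w i
        _ ≤ 4 * w.natAbs := by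
            rw [Finset.sum_const, Finset.card_range, nsmul_one]; exact_mod_cast hn
    · push Not at hn
      obtain ⟨m, rfl⟩ := Nat.exists_eq_add_of_le hn.le
      have hw0 : w.natAbs ≠ 0 := by
        intro h
        exact hw ⟨0, by simpa using h⟩
      rw [Finset.sum_range_add, sum_range_period_oddJacobi hw, zero_add]
      have : ∀ i, oddJacobi w (4 * w.natAbs + i) = oddJacobi w i := fun i => by
        rw [← oddJacobi_mod w (4 * w.natAbs + i), Nat.add_mod_left, oddJacobi_mod]
      simp only [this]
      exact ih m (by omega)

lemma sum_Ioc_filter_dvd {R : Type*} [AddCommMonoid R] (h : ℕ → R) (A B : ℕ) {D : ℕ} (hD : 0 < D) :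
    ∑ n ∈ Finset.Ioc A B with D ∣ n, h n = ∑ m ∈ Finset.Ioc (A / D) (B / D), h (D * m) := by
  symm
  refine Finset.sum_bij (fun m _ => D * m) ?_ ?_ ?_ ?_
  · intro m hm
    rw [Finset.mem_Ioc] at hm
    rw [Finset.mem_filter, Finset.mem_Ioc]
    exact ⟨⟨by rw [mul_comm]; exact (Nat.div_lt_iff_lt_mul hD).1 hm.1,
      by rw [mul_comm]; exact (Nat.le_div_iff_mul_le hD).1 hm.2⟩, Dvd.intro m rfl⟩
  · intro a _ b _ hab
    exact Nat.eq_of_mul_eq_mul_left hD hab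
  · intro n hn
    rw [Finset.mem_filter, Finset.mem_Ioc] at hn
    obtain ⟨⟨h1, h2⟩, m, rfl⟩ := hn
    refine ⟨m, ?_, rfl⟩
    rw [Finset.mem_Ioc]
    exact ⟨(Nat.div_lt_iff_lt_mul hD).2 (by rwa [mul_comm]),
      (Nat.le_div_iff_mul_le hD).2 (by rwa [mul_comm])⟩
  · intros; rfl

lemma abs_sum_Ioc_filter_dvd_oddJacobi_le {w : ℤ} (hw : ¬ IsSquare w) {A B D : ℕ} (hAB : A ≤ B)
    (hD : 0 < D) :
    |∑ n ∈ Finset.Ioc A B with D ∣ n, oddJacobi w n| ≤ 8 * w.natAbs := by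
  rw [sum_Ioc_filter_dvd _ _ _ hD]
  simp only [oddJacobi_mul_right]
  rw [← Finset.mul_sum, abs_mul]
  have h1 := abs_oddJacobi_le_one w D
  have h2 : ∑ m ∈ Finset.Ioc (A / D) (B / D), oddJacobi w m =
      ∑ i ∈ Finset.range (B / D + 1), oddJacobi w i -
        ∑ i ∈ Finset.range (A / D + 1), oddJacobi w i := by
    rw [← Finset.sum_Ico_eq_sub _ (Nat.succ_le_succ (Nat.div_le_div_right hAB))]
    refine Finset.sum_congr ?_ fun _ _ => rfl
    ext m
    simp only [Finset.mem_Ioc, Finset.mem_Ico]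
    omega
  have h3 := abs_sum_range_oddJacobi_le hw (B / D + 1)
  have h4 := abs_sum_range_oddJacobi_le hw (A / D + 1)
  have h5 := abs_sub (∑ i ∈ Finset.range (B / D + 1), oddJacobi w i)
    (∑ i ∈ Finset.range (A / D + 1), oddJacobi w i)
  rw [h2]
  calc _ ≤ 1 * |∑ i ∈ Finset.range (B / D + 1), oddJacobi w i -
        ∑ i ∈ Finset.range (A / D + 1), oddJacobi w i| := by gcongr
    _ ≤ _ := by linarith

lemma card_Ioc_filter_dvd_sub_le {A B D : ℕ} (hAB : A ≤ B) (hD : 0 < D) :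
    |((Finset.Ioc A B).filter (D ∣ ·)).card - ((B : ℝ) - A) / D| ≤ 1 := by
  have h : ((Finset.Ioc A B).filter (D ∣ ·)).card = B / D - A / D := by
    have := sum_Ioc_filter_dvd (fun _ => 1) A B hD
    simpa using this
  have hD' : (0 : ℝ) < D := by exact_mod_cast hD
  rw [h, Nat.cast_sub (Nat.div_le_div_right hAB), sub_div]
  have a1 := Nat.cast_div_le (α := ℝ) (m := A) (n := D)
  have b1 := Nat.cast_div_le (α := ℝ) (m := B) (n := D)
  have a2 : (A : ℝ) / D < (A / D : ℕ) + 1 := by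
    rw [div_lt_iff₀ hD']
    rw [mul_comm]
    exact_mod_cast Nat.lt_mul_div_succ _ hD
  have b2 : (B : ℝ) / D < (B / D : ℕ) + 1 := by
    rw [div_lt_iff₀ hD']
    rw [mul_comm]
    exact_mod_cast Nat.lt_mul_div_succ _ hD
  rw [abs_le]
  constructor <;> linarith

lemma sum_Icc_inv_sq_le_two (z : ℕ) : ∑ b ∈ Finset.Icc 1 z, 1 / (b : ℝ) ^ 2 ≤ 2 := by
  have : ∀ z : ℕ, ∑ b ∈ Finset.Icc 1 (z + 1), 1 / (b : ℝ) ^ 2 ≤ 2 - 1 / ((z : ℝ) + 1) := by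
    intro z
    induction z with
    | zero => norm_num
    | succ n ih =>
      rw [Finset.sum_Icc_succ_top (by omega)]
      have hn : (0 : ℝ) < (n : ℝ) + 1 := by positivity
      have : 1 / ((n + 1 + 1 : ℕ) : ℝ) ^ 2 ≤ 1 / ((n : ℝ) + 1) - 1 / ((n : ℝ) + 1 + 1) := by
        push_cast
        rw [div_sub_div _ _ hn.ne' (by positivity), div_le_div_iff₀ (by positivity) (by positivity)]
        nlinarith
      push_cast at this ⊢
      linarith
  rcases z with _ | z
  · simp
  · refine (this z).trans ?_
    have : (0 : ℝ) < 1 / ((z : ℝ) + 1) := by positivity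
    linarith

lemma log_le_two_mul_sum_moebius_sq_div_totient (z : ℕ) :
    Real.log z ≤ 2 * ∑ d ∈ Finset.Icc 1 z, (ArithmeticFunction.moebius d : ℝ) ^ 2 / d.totient := by
  classical
  choose! a b hab hsq using fun n : ℕ => Nat.sq_mul_squarefree n
  have h1 : ∑ n ∈ Finset.Icc 1 z, 1 / (n : ℝ) ≤
      ∑ p ∈ (Finset.Icc 1 z).filter Squarefree ×ˢ Finset.Icc 1 z,
        1 / (p.1 : ℝ) * (1 / (p.2 : ℝ) ^ 2) := by
    have hinj : Set.InjOn (fun n => (a n, b n)) (Finset.Icc 1 z : Set ℕ) := by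
      intro m _ n _ hmn
      simp only [Prod.mk.injEq] at hmn
      rw [← hab m, ← hab n, hmn.1, hmn.2]
    have : ∑ n ∈ Finset.Icc 1 z, 1 / (n : ℝ) =
        ∑ p ∈ (Finset.Icc 1 z).image (fun n => (a n, b n)),
          1 / (p.1 : ℝ) * (1 / (p.2 : ℝ) ^ 2) := by
      rw [Finset.sum_image hinj]
      refine Finset.sum_congr rfl fun n _ => ?_
      conv_lhs => rw [← hab n]
      push_cast
      rw [one_div_mul_one_div, mul_comm]
    rw [this]
    refine Finset.sum_le_sum_of_subset_of_nonneg ?_ fun _ _ _ => by positivity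
    intro p hp
    obtain ⟨n, hn, rfl⟩ := Finset.mem_image.1 hp
    rw [Finset.mem_Icc] at hn
    have hb : b n ≠ 0 := by
      intro h
      have := hab n
      rw [h] at this
      simp at this
      omega
    have ha : a n ≠ 0 := (hsq n).ne_zero
    have h1 : a n ≤ n := Nat.le_of_dvd hn.1 ⟨b n ^ 2, by rw [mul_comm]; exact (hab n).symm⟩
    have h2 : b n ≤ n := Nat.le_of_dvd hn.1 ⟨b n * a n, by
      rw [← mul_assoc, ← sq, hab n]⟩
    simp only [Finset.mem_product, Finset.mem_filter, Finset.mem_Icc]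
    exact ⟨⟨⟨Nat.one_le_iff_ne_zero.2 ha, by omega⟩, hsq n⟩, Nat.one_le_iff_ne_zero.2 hb, by omega⟩
  rw [Finset.sum_product] at h1
  simp only [← Finset.mul_sum] at h1
  have hlog : Real.log z ≤ ∑ n ∈ Finset.Icc 1 z, 1 / (n : ℝ) := by
    have := log_le_harmonic_floor (z : ℝ) (by positivity)
    rw [Nat.floor_natCast, harmonic_eq_sum_Icc] at this
    push_cast at this
    simpa using this
  refine (hlog.trans h1).trans ?_
  rw [Finset.mul_sum, Finset.sum_filter]
  refine Finset.sum_le_sum fun d hd => ?_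
  have hd1 : 1 ≤ d := (Finset.mem_Icc.1 hd).1
  split_ifs with h
  · have hμ : (ArithmeticFunction.moebius d : ℝ) ^ 2 = 1 := by
      exact_mod_cast ArithmeticFunction.moebius_sq_eq_one_of_squarefree h
    have hφ : (0 : ℝ) < d.totient := by exact_mod_cast Nat.totient_pos.2 hd1
    rw [hμ, mul_comm 2]
    refine mul_le_mul ?_ (sum_Icc_inv_sq_le_two z) (by positivity) (by positivity)
    exact one_div_le_one_div_of_le hφ (by exact_mod_cast Nat.totient_le d)
  · positivity

lemma sum_moebius_div_of_dvd {z δ m : ℕ} (hm : m ∈ Finset.Icc 1 z) (hδ : δ ∣ m) :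
    ∑ d ∈ Finset.Icc 1 z with δ ∣ d ∧ d ∣ m, (ArithmeticFunction.moebius (m / d) : ℝ) =
      if m = δ then 1 else 0 := by
  obtain ⟨k, rfl⟩ := hδ
  rw [Finset.mem_Icc] at hm
  have hδ0 : 0 < δ := Nat.pos_of_ne_zero (by rintro rfl; simp at hm)
  have hk0 : 0 < k := Nat.pos_of_ne_zero (by rintro rfl; simp at hm)
  have h1 : ∑ d ∈ Finset.Icc 1 z with δ ∣ d ∧ d ∣ δ * k,
      (ArithmeticFunction.moebius (δ * k / d) : ℝ) =
      ∑ e ∈ k.divisors, (ArithmeticFunction.moebius (k / e) : ℝ) := by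
    symm
    refine Finset.sum_bij (fun e _ => δ * e) ?_ ?_ ?_ ?_
    · intro e he
      have hek := (Nat.mem_divisors.1 he).1
      have he0 := Nat.pos_of_mem_divisors he
      have : δ * e ∣ δ * k := Nat.mul_dvd_mul_left δ hek
      simp only [Finset.mem_filter, Finset.mem_Icc]
      exact ⟨⟨Nat.mul_pos hδ0 he0, (Nat.le_of_dvd (by omega) this).trans hm.2⟩,
        Dvd.intro e rfl, this⟩
    · intro a _ b _ hab
      exact Nat.eq_of_mul_eq_mul_left hδ0 hab
    · intro d hd
      simp only [Finset.mem_filter] at hd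
      obtain ⟨-, ⟨e, rfl⟩, h⟩ := hd
      exact ⟨e, Nat.mem_divisors.2 ⟨Nat.dvd_of_mul_dvd_mul_left hδ0 h, hk0.ne'⟩, rfl⟩
    · intro e _
      rw [Nat.mul_div_mul_left _ _ hδ0]
  rw [h1, Nat.sum_div_divisors k (fun d => (ArithmeticFunction.moebius d : ℝ))]
  have h2 := ArithmeticFunction.coe_mul_zeta_apply (f := (ArithmeticFunction.moebius)) (x := k)
  rw [ArithmeticFunction.moebius_mul_coe_zeta, ArithmeticFunction.one_apply] at h2
  have h3 : δ * k = δ ↔ k = 1 := by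
    rw [Nat.mul_eq_left hδ0.ne']
  simp only [h3]
  exact_mod_cast h2.symm

lemma exists_selberg_weights {z : ℕ} (hz : 2 ≤ z) :
    ∃ l : ℕ → ℝ, l 1 = 1 ∧ (∀ d, |l d| ≤ d) ∧
      ∑ d ∈ Finset.Icc 1 z, ∑ e ∈ Finset.Icc 1 z, l d * l e / (Nat.lcm d e : ℝ) ≤
        2 / Real.log z := by
  classical
  set I := Finset.Icc 1 z with hI
  set S : ℝ := ∑ d ∈ I, (ArithmeticFunction.moebius d : ℝ) ^ 2 / d.totient with hS
  have hlog : 0 < Real.log z := Real.log_pos (by exact_mod_cast hz)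
  have hS2 : Real.log z ≤ 2 * S := log_le_two_mul_sum_moebius_sq_div_totient z
  have hS0 : 0 < S := by linarith
  set y : ℕ → ℝ := fun d => (ArithmeticFunction.moebius d : ℝ) / d.totient / S with hy
  set l : ℕ → ℝ := fun d => d * ∑ m ∈ I with d ∣ m, (ArithmeticFunction.moebius (m / d) : ℝ) * y m
    with hl
  have hIpos : ∀ d ∈ I, (0 : ℝ) < d := fun d hd => by
    exact_mod_cast (Finset.mem_Icc.1 hd).1
  have hinv : ∀ δ ∈ I, ∑ d ∈ I with δ ∣ d, l d / d = y δ := by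
    intro δ hδ
    have h1 : ∀ d ∈ I.filter (δ ∣ ·), l d / d =
        ∑ m ∈ I, if d ∣ m then (ArithmeticFunction.moebius (m / d) : ℝ) * y m else 0 := by
      intro d hd
      rw [Finset.mem_filter] at hd
      rw [← Finset.sum_filter]
      simp only [hl]
      rw [mul_div_cancel_left₀ _ (hIpos d hd.1).ne']
    rw [Finset.sum_congr rfl h1, Finset.sum_comm]
    have h2 : ∀ m ∈ I, ∑ d ∈ I with δ ∣ d,
        (if d ∣ m then (ArithmeticFunction.moebius (m / d) : ℝ) * y m else 0) =
        if m = δ then y m else 0 := by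
      intro m hm
      rw [← Finset.sum_filter, Finset.filter_filter, ← Finset.sum_mul]
      by_cases hδm : δ ∣ m
      · rw [sum_moebius_div_of_dvd hm hδm]
        split_ifs <;> simp
      · rw [Finset.filter_false_of_mem, Finset.sum_empty, zero_mul, if_neg]
        · rintro rfl; exact hδm dvd_rfl
        · rintro d - ⟨h, h'⟩; exact hδm (h.trans h')
    rw [Finset.sum_congr rfl h2, Finset.sum_ite_eq' I δ, if_pos hδ]
  refine ⟨l, ?_, ?_, ?_⟩
  · simp only [hl, hy, Nat.cast_one, one_mul, one_dvd, Finset.filter_true, Nat.div_one]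
    have : ∀ m ∈ I, (ArithmeticFunction.moebius m : ℝ) *
        ((ArithmeticFunction.moebius m : ℝ) / m.totient / S) =
        (ArithmeticFunction.moebius m : ℝ) ^ 2 / m.totient / S := fun m _ => by ring
    rw [Finset.sum_congr rfl this, ← Finset.sum_div, div_self hS0.ne']
  · intro d
    have hμ : ∀ n : ℕ, |(ArithmeticFunction.moebius n : ℝ)| ≤ 1 := fun n => by
      exact_mod_cast ArithmeticFunction.abs_moebius_le_one
    simp only [hl]
    rw [abs_mul, Nat.abs_cast]
    refine mul_le_of_le_one_right (Nat.cast_nonneg d) ?_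
    calc |∑ m ∈ I with d ∣ m, (ArithmeticFunction.moebius (m / d) : ℝ) * y m|
        ≤ ∑ m ∈ I with d ∣ m, |(ArithmeticFunction.moebius (m / d) : ℝ) * y m| :=
          Finset.abs_sum_le_sum_abs _ _
      _ ≤ ∑ m ∈ I, |(ArithmeticFunction.moebius (m / d) : ℝ) * y m| :=
          Finset.sum_le_sum_of_subset_of_nonneg (Finset.filter_subset _ _)
            fun _ _ _ => abs_nonneg _
      _ ≤ ∑ m ∈ I, (ArithmeticFunction.moebius m : ℝ) ^ 2 / m.totient / S := by
          refine Finset.sum_le_sum fun m _ => ?_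
          rw [abs_mul]
          refine (mul_le_of_le_one_left (abs_nonneg _) (hμ _)).trans (le_of_eq ?_)
          simp only [hy]
          rw [abs_div, abs_div, abs_of_pos hS0, Nat.abs_cast]
          congr 2
          rcases ArithmeticFunction.moebius_eq_or m with h | h | h <;> simp [h]
      _ = 1 := by rw [← Finset.sum_div, div_self hS0.ne']
  · have h1 : ∀ d ∈ I, ∀ e ∈ I, l d * l e / (Nat.lcm d e : ℝ) =
        ∑ δ ∈ I, (δ.totient : ℝ) * ((if δ ∣ d then l d / d else 0) *
          (if δ ∣ e then l e / e else 0)) := by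
      intro d hd e he
      have hd0 := hIpos d hd
      have he0 := hIpos e he
      have hg : ((Nat.gcd d e : ℕ) : ℝ) =
          ∑ δ ∈ I, if δ ∣ d ∧ δ ∣ e then (δ.totient : ℝ) else 0 := by
        rw [← Finset.sum_filter]
        have : I.filter (fun δ => δ ∣ d ∧ δ ∣ e) = (Nat.gcd d e).divisors := by
          ext δ
          have hd0' : 0 < d := by exact_mod_cast hd0
          simp only [Finset.mem_filter, Nat.mem_divisors, Nat.dvd_gcd_iff, hI, Finset.mem_Icc]
          constructor
          · rintro ⟨-, h⟩
            exact ⟨h, (Nat.gcd_pos_of_pos_left _ hd0').ne'⟩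
          · rintro ⟨h, -⟩
            exact ⟨⟨Nat.pos_of_dvd_of_pos h.1 hd0',
              (Nat.le_of_dvd hd0' h.1).trans (Finset.mem_Icc.1 hd).2⟩, h⟩
        rw [this]
        exact_mod_cast (Nat.sum_totient (Nat.gcd d e)).symm
      have hgl : ((Nat.gcd d e : ℕ) : ℝ) * (Nat.lcm d e : ℕ) = d * e := by
        exact_mod_cast Nat.gcd_mul_lcm d e
      have hl0 : ((Nat.lcm d e : ℕ) : ℝ) ≠ 0 := by
        intro h
        rw [h, mul_zero] at hgl
        exact (mul_pos hd0 he0).ne hgl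
      have : l d * l e / (Nat.lcm d e : ℝ) = (Nat.gcd d e : ℕ) * (l d / d * (l e / e)) := by
        rw [div_mul_div_comm, ← hgl]
        have hg0 : ((Nat.gcd d e : ℕ) : ℝ) ≠ 0 := by
          intro h
          rw [h, zero_mul] at hgl
          exact (mul_pos hd0 he0).ne hgl
        field_simp
      rw [this, hg, Finset.sum_mul]
      refine Finset.sum_congr rfl fun δ _ => ?_
      by_cases h1 : δ ∣ d <;> by_cases h2 : δ ∣ e <;> simp [h1, h2]
    have h2 : ∑ d ∈ I, ∑ e ∈ I, l d * l e / (Nat.lcm d e : ℝ) =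
        ∑ δ ∈ I, (δ.totient : ℝ) * (∑ d ∈ I with δ ∣ d, l d / d) ^ 2 := by
      rw [Finset.sum_congr rfl fun d hd => Finset.sum_congr rfl fun e he => h1 d hd e he]
      rw [Finset.sum_congr rfl fun d _ => Finset.sum_comm, Finset.sum_comm]
      refine Finset.sum_congr rfl fun δ _ => ?_
      simp only [← Finset.mul_sum]
      rw [sq, ← Finset.sum_mul, Finset.sum_filter]
    rw [h2, Finset.sum_congr rfl fun δ hδ => by rw [hinv δ hδ]]
    have h3 : ∀ δ ∈ I, (δ.totient : ℝ) * y δ ^ 2 =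
        (ArithmeticFunction.moebius δ : ℝ) ^ 2 / δ.totient / S ^ 2 := by
      intro δ hδ
      have : (0 : ℝ) < δ.totient := by
        exact_mod_cast Nat.totient_pos.2 (Finset.mem_Icc.1 hδ).1
      simp only [hy]
      field_simp
    rw [Finset.sum_congr rfl h3, ← Finset.sum_div, ← hS, div_le_div_iff₀ (by positivity) hlog]
    nlinarith

lemma sum_sq_sum_dvd_mul (I N : Finset ℕ) (l h : ℕ → ℝ) :
    ∑ n ∈ N, (∑ d ∈ I with d ∣ n, l d) ^ 2 * h n =
      ∑ d ∈ I, ∑ e ∈ I, l d * l e * ∑ n ∈ N with Nat.lcm d e ∣ n, h n := by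
  have h1 : ∀ n ∈ N, (∑ d ∈ I with d ∣ n, l d) ^ 2 * h n =
      ∑ d ∈ I, ∑ e ∈ I, l d * l e * (if Nat.lcm d e ∣ n then h n else 0) := by
    intro n _
    rw [sq, Finset.sum_filter, Finset.sum_mul_sum, Finset.sum_mul]
    refine Finset.sum_congr rfl fun d _ => ?_
    rw [Finset.sum_mul]
    refine Finset.sum_congr rfl fun e _ => ?_
    simp only [Nat.lcm_dvd_iff]
    by_cases h1 : d ∣ n <;> by_cases h2 : e ∣ n <;> simp [h1, h2]
  rw [Finset.sum_congr rfl h1, Finset.sum_comm]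
  refine Finset.sum_congr rfl fun d _ => ?_
  rw [Finset.sum_comm]
  refine Finset.sum_congr rfl fun e _ => ?_
  rw [← Finset.mul_sum, Finset.sum_filter]

lemma sq_mul_card_primes_le {Q z K T W : ℕ} (hQ : 1 ≤ Q) (hz : 2 ≤ z) (w : Fin K → ℤ)
    (hT : ∀ i, {j | IsSquare (w i * w j)}.ncard ≤ T) (hW : ∀ i, (w i).natAbs ≤ W) (P : Finset ℕ)
    (hP : ∀ p ∈ P, p.Prime ∧ z < p ∧ Q ≤ p ∧ p ≤ 2 * Q ∧ ∀ i, J(w i | p) = -1) :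
    (K : ℝ) ^ 2 * P.card ≤ K * T * (2 * (Q + 1) / Real.log z + z ^ 4) +
      K ^ 2 * (z ^ 4 * (8 * W ^ 2)) := by
  classical
  obtain ⟨l, hl1, hl, hmain⟩ := exists_selberg_weights hz
  set I := Finset.Icc 1 z with hI
  set N := Finset.Ioc (Q - 1) (2 * Q) with hN
  have hQ2 : Q - 1 ≤ 2 * Q := by omega
  have hIpos : ∀ d ∈ I, ∀ e ∈ I, 0 < Nat.lcm d e := fun d hd e he =>
    Nat.lcm_pos (Finset.mem_Icc.1 hd).1 (Finset.mem_Icc.1 he).1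
  have hIz : ∀ d ∈ I, |l d| ≤ z := fun d hd =>
    (hl d).trans (by exact_mod_cast (Finset.mem_Icc.1 hd).2)
  have hll : ∑ d ∈ I, ∑ e ∈ I, |l d * l e| ≤ (z : ℝ) ^ 4 := by
    calc ∑ d ∈ I, ∑ e ∈ I, |l d * l e| ≤ ∑ d ∈ I, ∑ e ∈ I, (z : ℝ) * z := by
          refine Finset.sum_le_sum fun d hd => Finset.sum_le_sum fun e he => ?_
          rw [abs_mul]
          exact mul_le_mul (hIz d hd) (hIz e he) (abs_nonneg _) (Nat.cast_nonneg _)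
      _ = (z : ℝ) ^ 4 := by simp [hI]; ring
  set g : ℕ → ℝ := fun n => (∑ d ∈ I with d ∣ n, l d) ^ 2 with hg
  have hg0 : ∀ n, 0 ≤ g n := fun n => sq_nonneg _
  have hgsum : ∑ n ∈ N, g n ≤ 2 * (Q + 1) / Real.log z + z ^ 4 := by
    have h1 := sum_sq_sum_dvd_mul I N l (fun _ => 1)
    simp only [mul_one] at h1
    rw [h1]
    have h2 : ∀ d ∈ I, ∀ e ∈ I, l d * l e * ∑ n ∈ N with Nat.lcm d e ∣ n, (1 : ℝ) ≤
        (Q + 1) * (l d * l e / (Nat.lcm d e : ℝ)) + |l d * l e| := by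
      intro d hd e he
      have h3 := card_Ioc_filter_dvd_sub_le hQ2 (hIpos d hd e he)
      rw [Finset.sum_const, nsmul_one]
      set c : ℝ := ((N.filter (Nat.lcm d e ∣ ·)).card : ℝ)
      have h4 : ((2 * Q : ℕ) : ℝ) - ((Q - 1 : ℕ) : ℝ) = Q + 1 := by
        rw [Nat.cast_sub hQ]; push_cast; ring
      rw [h4] at h3
      have h5 : l d * l e * (c - (Q + 1) / (Nat.lcm d e : ℝ)) ≤ |l d * l e| := by
        refine (le_abs_self _).trans ?_
        rw [abs_mul]
        exact mul_le_of_le_one_right (abs_nonneg _) h3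
      have h6 : l d * l e * (c - (Q + 1) / (Nat.lcm d e : ℝ)) =
        l d * l e * c - (Q + 1) * (l d * l e / (Nat.lcm d e : ℝ)) := by ring
      linarith
    calc _ ≤ ∑ d ∈ I, ∑ e ∈ I, ((Q + 1) * (l d * l e / (Nat.lcm d e : ℝ)) + |l d * l e|) :=
          Finset.sum_le_sum fun d hd => Finset.sum_le_sum fun e he => h2 d hd e he
      _ = (Q + 1) * ∑ d ∈ I, ∑ e ∈ I, (l d * l e / (Nat.lcm d e : ℝ)) +
          ∑ d ∈ I, ∑ e ∈ I, |l d * l e| := by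
          simp only [Finset.sum_add_distrib, Finset.mul_sum]
      _ ≤ (Q + 1) * (2 / Real.log z) + z ^ 4 := by gcongr
      _ = _ := by ring
  have hpair : ∀ i j, ¬ IsSquare (w i * w j) →
      ∑ n ∈ N, g n * (oddJacobi (w i * w j) n : ℝ) ≤ z ^ 4 * (8 * W ^ 2) := by
    intro i j hij
    rw [sum_sq_sum_dvd_mul I N l (fun n => (oddJacobi (w i * w j) n : ℝ))]
    have hwW : ((w i * w j).natAbs : ℝ) ≤ W ^ 2 := by
      rw [Int.natAbs_mul, sq]
      push_cast
      exact mul_le_mul (by exact_mod_cast hW i) (by exact_mod_cast hW j) (by positivity)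
        (by positivity)
    have h2 : ∀ d ∈ I, ∀ e ∈ I,
        l d * l e * ∑ n ∈ N with Nat.lcm d e ∣ n, (oddJacobi (w i * w j) n : ℝ) ≤
        |l d * l e| * (8 * W ^ 2) := by
      intro d hd e he
      refine (le_abs_self _).trans ?_
      rw [abs_mul]
      refine mul_le_mul_of_nonneg_left ?_ (abs_nonneg _)
      have h3 := abs_sum_Ioc_filter_dvd_oddJacobi_le hij hQ2 (hIpos d hd e he)
      have h4 : |∑ n ∈ N with Nat.lcm d e ∣ n, (oddJacobi (w i * w j) n : ℝ)| ≤
        8 * ((w i * w j).natAbs : ℝ) := by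
        rw [hN, ← Int.cast_sum, ← Int.cast_abs]
        refine (Int.cast_le.2 h3).trans_eq ?_
        rw [Int.cast_mul, Int.cast_natCast, Int.cast_ofNat]
      linarith
    calc _ ≤ ∑ d ∈ I, ∑ e ∈ I, |l d * l e| * (8 * W ^ 2) :=
          Finset.sum_le_sum fun d hd => Finset.sum_le_sum fun e he => h2 d hd e he
      _ = (∑ d ∈ I, ∑ e ∈ I, |l d * l e|) * (8 * W ^ 2) := by simp only [Finset.sum_mul]
      _ ≤ _ := by gcongr
  have hpair' : ∀ i j, ∑ n ∈ N, g n * (oddJacobi (w i * w j) n : ℝ) ≤ ∑ n ∈ N, g n := by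
    intro i j
    refine Finset.sum_le_sum fun n _ => mul_le_of_le_one_right (hg0 n) ?_
    exact_mod_cast (abs_le.1 (abs_oddJacobi_le_one (w i * w j) n)).2
  have hlow : (K : ℝ) ^ 2 * P.card ≤
      ∑ n ∈ N, g n * (∑ i, (oddJacobi (w i) n : ℝ)) ^ 2 := by
    have hPN : P ⊆ N := by
      intro p hp
      obtain ⟨-, -, h1, h2, -⟩ := hP p hp
      rw [hN, Finset.mem_Ioc]
      omega
    refine le_trans ?_ (Finset.sum_le_sum_of_subset_of_nonneg hPN
      fun n _ _ => mul_nonneg (hg0 n) (sq_nonneg _))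
    have : ∀ p ∈ P, g p * (∑ i, (oddJacobi (w i) p : ℝ)) ^ 2 = (K : ℝ) ^ 2 := by
      intro p hp
      obtain ⟨hpp, hzp, -, -, hJ⟩ := hP p hp
      have hodd : Odd p := hpp.odd_of_ne_two (by omega)
      have h1 : I.filter (· ∣ p) = {1} := by
        ext d
        simp only [hI, Finset.mem_filter, Finset.mem_Icc, Finset.mem_singleton]
        constructor
        · rintro ⟨⟨-, h2⟩, h3⟩
          rcases (Nat.dvd_prime hpp).1 h3 with h | h
          · exact h
          · omega
        · rintro rfl
          exact ⟨⟨le_rfl, by omega⟩, one_dvd p⟩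
      simp only [hg, h1, Finset.sum_singleton, hl1, oddJacobi_of_odd _ hodd, hJ]
      simp
    rw [Finset.sum_congr rfl this, Finset.sum_const, nsmul_eq_mul, mul_comm]
  have hexp : ∑ n ∈ N, g n * (∑ i, (oddJacobi (w i) n : ℝ)) ^ 2 =
      ∑ i, ∑ j, ∑ n ∈ N, g n * (oddJacobi (w i * w j) n : ℝ) := by
    rw [Finset.sum_congr rfl fun i _ => Finset.sum_comm, Finset.sum_comm]
    refine Finset.sum_congr rfl fun n _ => ?_
    rw [sq, Finset.sum_mul_sum, Finset.mul_sum]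
    refine Finset.sum_congr rfl fun i _ => ?_
    rw [Finset.mul_sum]
    refine Finset.sum_congr rfl fun j _ => ?_
    rw [oddJacobi_mul_left]
    push_cast
    rfl
  have hG0 : 0 ≤ ∑ n ∈ N, g n := Finset.sum_nonneg fun n _ => hg0 n
  have hrow : ∀ i, ∑ j, ∑ n ∈ N, g n * (oddJacobi (w i * w j) n : ℝ) ≤
      T * (∑ n ∈ N, g n) + K * (z ^ 4 * (8 * W ^ 2)) := by
    intro i
    have h1 : ∀ j, ∑ n ∈ N, g n * (oddJacobi (w i * w j) n : ℝ) ≤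
        (if IsSquare (w i * w j) then ∑ n ∈ N, g n else 0) + z ^ 4 * (8 * W ^ 2) := by
      intro j
      split_ifs with h
      · exact (hpair' i j).trans (le_add_of_nonneg_right (by positivity))
      · rw [zero_add]; exact hpair i j h
    refine (Finset.sum_le_sum fun j _ => h1 j).trans ?_
    rw [Finset.sum_add_distrib, ← Finset.sum_filter, Finset.sum_const, Finset.sum_const,
      Finset.card_univ, Fintype.card_fin, nsmul_eq_mul, nsmul_eq_mul]
    have h2 : ((Finset.univ.filter fun j => IsSquare (w i * w j)).card : ℝ) ≤ T := by
      have := hT i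
      rw [Set.ncard_eq_toFinset_card'] at this
      simp only [Set.toFinset_ofPred] at this
      exact_mod_cast this
    gcongr
  calc _ ≤ _ := hlow
    _ = _ := hexp
    _ ≤ ∑ i : Fin K, (T * (∑ n ∈ N, g n) + K * (z ^ 4 * (8 * W ^ 2))) :=
        Finset.sum_le_sum fun i _ => hrow i
    _ = K * T * (∑ n ∈ N, g n) + K ^ 2 * (z ^ 4 * (8 * W ^ 2)) := by
        rw [Finset.sum_const, Finset.card_univ, Fintype.card_fin, nsmul_eq_mul]; ring
    _ ≤ _ := by gcongr

lemma not_isSquare_discr_of_even_finrank {F L : Type*} [Field F] [Fintype F] [Field L] [Finite L]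
    [Algebra F L] (hF : ringChar F ≠ 2) {n : ℕ} (hn : Even n)
    (b : Module.Basis (Fin n) F L) : ¬ IsSquare (Algebra.discr F b) := by
  obtain rfl : n = Module.finrank F L := by
    rw [Module.finrank_eq_card_basis b, Fintype.card_fin]
  have : Finite F := inferInstance
  have : Module.Finite F L := Module.Finite.of_finite
  let E := AlgebraicClosure L
  let q := Fintype.card F
  let e₀ : Fin (Module.finrank F L) → (L →ₐ[F] E) := fun n =>
    (IsScalarTower.toAlgHom F L E).comp (FiniteField.frobeniusAlgHom F L ^ n.1)
  have he₀ : Function.Bijective e₀ := by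
    rw [Fintype.bijective_iff_injective_and_card]
    constructor
    · intro i j hij
      refine (FiniteField.bijective_frobeniusAlgHom_pow F L).1 ?_
      ext x
      have := DFunLike.congr_fun hij x
      simpa [e₀] using this
    · rw [AlgHom.card, Fintype.card_fin]
  let e := Equiv.ofBijective e₀ he₀
  have hval : ∀ (i : Fin (Module.finrank F L)) (x : L), e i x = algebraMap L E (x ^ q ^ i.1) := by
    intro i x
    change algebraMap L E ((FiniteField.frobeniusAlgHom F L ^ i.1) x) = _
    rw [AlgHom.coe_pow, FiniteField.coe_frobeniusAlgHom, pow_iterate]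
  set M := Algebra.embeddingsMatrixReindex F E b e with hM
  have hMval : ∀ i j, M i j = algebraMap L E (b i ^ q ^ j.1) := fun i j => hval j (b i)
  have hsq := Algebra.discr_eq_det_embeddingsMatrixReindex_pow_two F E b e
  have hne : M.det ≠ 0 := by
    intro h
    rw [h, zero_pow two_ne_zero, map_eq_zero] at hsq
    exact Algebra.discr_not_zero_of_basis F b hsq
  have hfrob : M.det ^ q = - M.det := by
    have h1 : M.det ^ q = (M.map (FiniteField.frobeniusAlgHom F E)).det := by
      rw [← AlgHom.coe_toRingHom, ← RingHom.mapMatrix_apply, ← RingHom.map_det]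
      rfl
    have h2 : M.map (FiniteField.frobeniusAlgHom F E) =
        M.submatrix id (finRotate (Module.finrank F L)) := by
      ext i j
      obtain ⟨m, hm⟩ : ∃ m, Module.finrank F L = m + 1 :=
        Nat.exists_eq_succ_of_ne_zero Module.finrank_pos.ne'
      rw [Matrix.map_apply, Matrix.submatrix_apply, hMval, hMval,
        FiniteField.frobeniusAlgHom_apply, ← map_pow, ← pow_mul, ← pow_succ, id]
      congr 1
      by_cases hj : j.1 + 1 < Module.finrank F L
      · have : (finRotate (Module.finrank F L) j).1 = j.1 + 1 := by
          have hj' : j.1 < Module.finrank F L - 1 := by omega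
          clear_value q
          generalize Module.finrank F L = n at *
          subst hm
          rw [coe_finRotate_of_ne_last]
          intro h; simp [h] at hj
        rw [this]
      · have h3 : (finRotate (Module.finrank F L) j).1 = 0 := by
          generalize Module.finrank F L = n at *
          subst hm
          have : j = Fin.last m := by ext; simp; omega
          rw [this, finRotate_last]; rfl
        have h4 : j.1 + 1 = Module.finrank F L := by omega
        have := Fintype.ofFinite L
        rw [h3, h4, ← Module.card_eq_pow_finrank (K := F) (V := L), FiniteField.pow_card, pow_zero,
          pow_one]
    rw [h1, h2, Matrix.det_permute', sign_finRotate]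
    have : Odd (Module.finrank F L - 1) :=
      Nat.Even.sub_odd Module.finrank_pos hn odd_one
    rw [this.neg_one_pow, Units.val_neg, Units.val_one, Int.cast_neg, Int.cast_one, neg_one_mul]
  rintro ⟨c, hc⟩
  have hfix : M.det ^ q = M.det := by
    have h1 : M.det ^ 2 = algebraMap F E c ^ 2 := by rw [hM, ← hsq, hc, map_mul, sq]
    have h2 : ∃ c' : F, M.det = algebraMap F E c' := by
      rcases sq_eq_sq_iff_eq_or_eq_neg.1 h1 with h | h
      · exact ⟨c, h⟩
      · exact ⟨-c, by rw [h, map_neg]⟩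
    obtain ⟨c', h2⟩ := h2
    rw [h2, ← map_pow, FiniteField.pow_card]
  have h2 : (2 : E) ≠ 0 := by
    rw [← map_ofNat (algebraMap F E) 2, _root_.map_ne_zero]
    exact Ring.two_ne_zero hF
  apply mul_ne_zero h2 hne
  rw [two_mul]
  nth_rewrite 1 [← hfix]
  rw [hfrob, neg_add_cancel]

lemma mem_range_algebraMap_of_pow_card_eq {F L : Type*} [Field F] [Fintype F] [Field L]
    [Algebra F L] {x : L} (hx : x ^ Fintype.card F = x) : x ∈ Set.range (algebraMap F L) := by
  have hs : (X ^ Fintype.card F - X : F[X]).Splits := by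
    rw [splits_iff_card_roots, FiniteField.roots_X_pow_card_sub_X,
      FiniteField.X_pow_card_sub_X_natDegree_eq _ Fintype.one_lt_card]
    rfl
  refine hs.mem_range_of_isRoot (FiniteField.X_pow_card_sub_X_ne_zero F Fintype.one_lt_card) ?_
  simp [hx]

lemma isSquare_norm_of_pow_eq {F L : Type*} [Field F] [Fintype F] [Field L] [Finite L]
    [Algebra F L] {h : ℕ} (hL : Module.finrank F L = 2 * h) {y : L}
    (hy : y ^ Fintype.card F ^ h = y) : IsSquare (Algebra.norm F y) := by
  have : Module.Finite F L := Module.Finite.of_finite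
  rcases eq_or_ne y 0 with rfl | hy0
  · simp
  set η := ∏ i ∈ Finset.range h, y ^ Fintype.card F ^ i with hη
  have h1 : η ^ Fintype.card F = η := by
    have h2 := Finset.prod_range_succ' (fun i => y ^ Fintype.card F ^ i) h
    rw [Finset.prod_range_succ, hy, pow_zero, pow_one] at h2
    rw [← hη] at h2
    refine Eq.trans ?_ (mul_right_cancel₀ hy0 h2).symm
    rw [hη, ← Finset.prod_pow]
    exact Finset.prod_congr rfl fun i _ => by rw [pow_succ, pow_mul]
  obtain ⟨c, hc⟩ := mem_range_algebraMap_of_pow_card_eq h1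
  refine ⟨c, (algebraMap F L).injective ?_⟩
  rw [FiniteField.algebraMap_norm_eq_prod_pow, hL, two_mul, Finset.prod_range_add, map_mul, hc,
    Nat.card_eq_fintype_card]
  congr 1
  exact Finset.prod_congr rfl fun i _ => by rw [pow_add, pow_mul, hy]

lemma norm_algebraMap_sub_gen {F L : Type*} [Field F] [Field L] [Algebra F L]
    (pb : PowerBasis F L) (t : F) :
    Algebra.norm F (algebraMap F L t - pb.gen) = (minpoly F pb.gen).eval t := by
  have : Module.Finite F L := pb.finite
  rw [← charpoly_leftMulMatrix, Algebra.leftMulMatrix_apply, LinearMap.charpoly_toMatrix,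
    LinearMap.eval_charpoly, Algebra.norm_apply]
  congr 1
  ext x
  simp [Algebra.smul_def]

lemma pow_card_pow_eq_of_natDegree_dvd {F L : Type*} [Field F] [Fintype F] [Field L]
    [Algebra F L] {Q : F[X]} (hQ : Irreducible Q) {h : ℕ} (hd : Q.natDegree ∣ h) {x : L}
    (hx : aeval x Q = 0) : x ^ Fintype.card F ^ h = x := by
  obtain ⟨R, hR⟩ := hQ.natDegree_dvd_iff_dvd_X_pow_card_pow_sub_X.1 hd
  have := congrArg (aeval x) hR
  rw [map_mul, hx, zero_mul, map_sub, map_pow, aeval_X, sub_eq_zero,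
    Nat.card_eq_fintype_card] at this
  exact this

lemma not_isSquare_leadingCoeff_mul_eval {F : Type*} [Field F] [Fintype F] (hF : ringChar F ≠ 2)
    {Q f g : F[X]} {a b : F} (ha : a ≠ 0) (hP : Irreducible (Q.comp f)) (hQ : Irreducible Q)
    (hfd : Even f.natDegree) (hQd : Even Q.natDegree)
    (hf : derivative f = g ^ 2 * (C a * X + C b)) :
    ¬ IsSquare ((Q.comp f).leadingCoeff * (Q.comp f).eval (-b / a)) := by
  set P := Q.comp f with hPdef
  have hP0 : P ≠ 0 := hP.ne_zero
  have : Fact (Irreducible P) := ⟨hP⟩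
  let pb := AdjoinRoot.powerBasis hP0
  have hfin : Module.Finite F (AdjoinRoot P) := pb.finite
  have : Finite (AdjoinRoot P) := Module.finite_of_finite F
  have hdim : Module.finrank F (AdjoinRoot P) = P.natDegree := by
    rw [pb.finrank, AdjoinRoot.powerBasis_dim]
  obtain ⟨d, hd⟩ := hfd.two_dvd
  obtain ⟨e, he⟩ := hQd.two_dvd
  have hPd : P.natDegree = 2 * (Q.natDegree * d) := by rw [hPdef, natDegree_comp, hd]; ring
  have heven : Even P.natDegree := hPd ▸ even_two_mul _
  set β := AdjoinRoot.root P with hβ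
  have hgen : pb.gen = β := AdjoinRoot.powerBasis_gen hP0
  have hmin : minpoly F β = P * C P.leadingCoeff⁻¹ := AdjoinRoot.minpoly_root hP0
  have hdisc := not_isSquare_discr_of_even_finrank hF
    (show Even pb.dim by rwa [AdjoinRoot.powerBasis_dim]) pb.basis
  have hsign :
      Even (Module.finrank F (AdjoinRoot P) * (Module.finrank F (AdjoinRoot P) - 1) / 2) := by
    have h1 : Module.finrank F (AdjoinRoot P) = 2 * (2 * (e * d)) := by
      rw [hdim, hPd, he]; ring
    rw [h1, mul_assoc 2 (2 * (e * d)), Nat.mul_div_cancel_left _ two_pos, mul_assoc 2]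
    exact even_two_mul _
  rw [Algebra.discr_powerBasis_eq_norm, hsign.neg_one_pow, one_mul, hgen, hmin] at hdisc
  set y := aeval (aeval β f) (derivative Q) with hy
  have hPder : aeval β (derivative (P * C P.leadingCoeff⁻¹)) =
      algebraMap F _ P.leadingCoeff⁻¹ * (aeval β g ^ 2 *
        (algebraMap F _ (-a) * (algebraMap F _ (-b / a) - β)) * y) := by
    have hder : derivative P = g ^ 2 * (C a * X + C b) * (derivative Q).comp f := by
      rw [hPdef, derivative_comp, hf]
    rw [derivative_mul, derivative_C, mul_zero, add_zero, hder, hy]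
    have : algebraMap F (AdjoinRoot P) (-a) * (algebraMap F _ (-b / a) - β) =
        algebraMap F _ a * β + algebraMap F _ b := by
      rw [mul_sub, ← map_mul, neg_mul, mul_div_cancel₀ _ ha, map_neg]
      simp
      ring
    rw [this]
    simp [aeval_comp]
    ring
  have hysq : IsSquare (Algebra.norm F y) := by
    refine isSquare_norm_of_pow_eq (hdim.trans hPd) ?_
    have hfix : aeval β f ^ Fintype.card F ^ (Q.natDegree * d) = aeval β f := by
      refine pow_card_pow_eq_of_natDegree_dvd hQ (dvd_mul_right _ _) ?_
      rw [← aeval_comp, ← hPdef, AdjoinRoot.aeval_eq, AdjoinRoot.mk_self]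
    have hφ : ∀ x : AdjoinRoot P, x ^ Fintype.card F ^ (Q.natDegree * d) =
        (FiniteField.frobeniusAlgHom F (AdjoinRoot P) ^ (Q.natDegree * d)) x := fun x => by
      rw [AlgHom.coe_pow, FiniteField.coe_frobeniusAlgHom, pow_iterate]
    rw [hφ, hy, ← aeval_algHom_apply, ← hφ, hfix]
  have hDsq : ∀ c : F, IsSquare (c ^ P.natDegree) := fun c => heven.isSquare_pow c
  rintro hsq
  apply hdisc
  rw [hPder, map_mul, map_mul, map_mul, map_mul, map_pow, Algebra.norm_algebraMap,
    Algebra.norm_algebraMap, ← hgen, norm_algebraMap_sub_gen, hgen, hmin, hdim, eval_mul, eval_C]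
  have : P.eval (-b / a) * P.leadingCoeff⁻¹ =
      P.leadingCoeff * P.eval (-b / a) * P.leadingCoeff⁻¹ ^ 2 := by
    have := leadingCoeff_ne_zero.2 hP0
    field_simp
  rw [this]
  exact (hDsq _).mul (((IsSquare.sq _).mul ((hDsq _).mul (hsq.mul (IsSquare.sq _)))).mul hysq)

section Iterates

variable {R : Type*} [CommRing R]

lemma polyIter_one (f : R[X]) : polyIter f 1 = f := by simp [polyIter]

lemma polyIter_map {S : Type*} [CommRing S] (φ : R →+* S) (f : R[X]) (n : ℕ) :
    (polyIter f n).map φ = polyIter (f.map φ) n := by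
  induction n with
  | zero => simp [polyIter]
  | succ n ih => rw [polyIter, polyIter, Polynomial.map_comp, ih]

lemma polyIter_add (f : R[X]) (m n : ℕ) :
    polyIter f (m + n) = (polyIter f m).comp (polyIter f n) := by
  induction m with
  | zero => simp [polyIter]
  | succ m ih => rw [Nat.succ_add, polyIter, polyIter, ih, comp_assoc]

variable [IsDomain R]

lemma natDegree_polyIter (f : R[X]) (n : ℕ) : (polyIter f n).natDegree = f.natDegree ^ n := by
  induction n with
  | zero => simp [polyIter]
  | succ n ih => rw [polyIter, natDegree_comp, ih, pow_succ']

lemma leadingCoeff_polyIter_add {f : R[X]} (hf : f.natDegree ≠ 0) (m n : ℕ) :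
    (polyIter f (m + n)).leadingCoeff =
      (polyIter f m).leadingCoeff * (polyIter f n).leadingCoeff ^ f.natDegree ^ m := by
  rw [polyIter_add, leadingCoeff_comp, natDegree_polyIter]
  rw [natDegree_polyIter]
  exact pow_ne_zero _ hf

lemma polyIter_ne_zero {f : R[X]} (hf : f.natDegree ≠ 0) (n : ℕ) : polyIter f n ≠ 0 := by
  intro h
  have := natDegree_polyIter f n
  rw [h, natDegree_zero] at this
  exact pow_ne_zero n hf this.symm

lemma map_leadingCoeff_polyIter_ne_zero {S : Type*} [CommRing S] [IsDomain S] (φ : R →+* S)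
    {f : R[X]} (hf : f.natDegree ≠ 0) (hφ : φ f.leadingCoeff ≠ 0) (n : ℕ) :
    φ (polyIter f n).leadingCoeff ≠ 0 := by
  induction n with
  | zero => simp [polyIter]
  | succ n ih =>
    rw [add_comm, leadingCoeff_polyIter_add hf, polyIter_one, map_mul, map_pow]
    exact mul_ne_zero hφ (pow_ne_zero _ ih)

end Iterates

/-- The integer `c_n a^{d^n} f^(n)(-b/a)`, where `c_n` is the leading coefficient of `f^(n)`. -/
noncomputable def critInt (f : ℤ[X]) (a b : ℤ) (n : ℕ) : ℤ :=
  (polyIter f n).leadingCoeff * ((polyIter f n).scaleRoots a).eval (-b)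

lemma map_critInt {K : Type*} [Field K] (φ : ℤ →+* K) {f : ℤ[X]} {a b : ℤ} (ha : φ a ≠ 0) (n : ℕ) :
    φ (critInt f a b n) = φ (polyIter f n).leadingCoeff *
      (φ a ^ f.natDegree ^ n * ((polyIter f n).map φ).eval (-φ b / φ a)) := by
  have h := scaleRoots_eval₂_mul (p := polyIter f n) (f := φ) (-φ b / φ a) a
  rw [mul_div_cancel₀ _ ha, natDegree_polyIter, ← map_neg] at h
  rw [critInt, map_mul, ← eval₂_at_apply, h, eval_map, map_neg]

lemma jacobiSym_critInt_eq_neg_one {f g : ℤ[X]} {a b : ℤ} (hdeg : f.natDegree ≠ 0)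
    (heven : Even f.natDegree) (hder : derivative f = g ^ 2 * (C a * X + C b)) {p : ℕ}
    (hp : p.Prime) (hp2 : p ≠ 2) (hpa : ¬ (p : ℤ) ∣ a) (hpc : ¬ (p : ℤ) ∣ f.leadingCoeff)
    (hirr : DynIrred (f.map (Int.castRingHom (ZMod p)))) {n : ℕ} (hn : 2 ≤ n) :
    J(critInt f a b n | p) = -1 := by
  have : Fact p.Prime := ⟨hp⟩
  rw [ZMod.nonsquare_iff_jacobiSym_eq_neg_one]
  set φ := Int.castRingHom (ZMod p) with hφ
  have ha : φ a ≠ 0 := by rwa [hφ, eq_intCast, Ne, ZMod.intCast_zmod_eq_zero_iff_dvd]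
  have hc : φ f.leadingCoeff ≠ 0 := by
    rwa [hφ, eq_intCast, Ne, ZMod.intCast_zmod_eq_zero_iff_dvd]
  obtain ⟨k, rfl⟩ : ∃ k, n = k + 1 := ⟨n - 1, by omega⟩
  have hd : (f.map φ).natDegree = f.natDegree := natDegree_map_of_leadingCoeff_ne_zero _ hc
  have key := not_isSquare_leadingCoeff_mul_eval (F := ZMod p) (Q := polyIter (f.map φ) k)
    (f := f.map φ) (g := g.map φ) (a := φ a) (b := φ b) (by rwa [ZMod.ringChar_zmod_n]) ha
    (by
      have := polyIter_add (f.map φ) k 1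
      rw [polyIter_one] at this
      rw [← this]
      exact hirr _ (by omega)) (hirr _ (by omega)) (by rwa [hd])
    (by
      rw [natDegree_polyIter, hd]
      exact heven.pow_of_ne_zero (by omega))
    (by rw [derivative_map, hder]; simp)
  have hcomp : (polyIter (f.map φ) k).comp (f.map φ) = (polyIter f (k + 1)).map φ := by
    rw [polyIter_map, polyIter_add, polyIter_one]
  rw [hcomp, leadingCoeff_map_of_leadingCoeff_ne_zero _
    (map_leadingCoeff_polyIter_ne_zero φ hdeg hc _)] at key
  intro hsq
  apply key
  have hval := map_critInt φ (f := f) (b := b) ha (k + 1)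
  have hcast : φ (critInt f a b (k + 1)) = ((critInt f a b (k + 1) : ℤ) : ZMod p) := rfl
  rw [← hcast, hval] at hsq
  obtain ⟨r, hr⟩ := (heven.pow_of_ne_zero k.succ_ne_zero).two_dvd
  have : φ (polyIter f (k + 1)).leadingCoeff * ((polyIter f (k + 1)).map φ).eval (-φ b / φ a) =
      φ (polyIter f (k + 1)).leadingCoeff * (φ a ^ f.natDegree ^ (k + 1) *
        ((polyIter f (k + 1)).map φ).eval (-φ b / φ a)) * ((φ a ^ r)⁻¹) ^ 2 := by
    rw [hr]
    field_simp
    ring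
  rw [this]
  exact hsq.mul (IsSquare.sq _)

/-- The sum of the absolute values of the coefficients of an integer polynomial. -/
def coeffSum (P : ℤ[X]) : ℕ := ∑ i ∈ P.support, (P.coeff i).natAbs

lemma coeffSum_eq_sum_of_subset {P : ℤ[X]} {s : Finset ℕ} (h : P.support ⊆ s) :
    coeffSum P = ∑ i ∈ s, (P.coeff i).natAbs :=
  Finset.sum_subset h fun i _ hi => by rw [notMem_support_iff.1 hi, Int.natAbs_zero]

lemma natAbs_coeff_le_coeffSum (P : ℤ[X]) (i : ℕ) : (P.coeff i).natAbs ≤ coeffSum P := by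
  by_cases hi : i ∈ P.support
  · exact Finset.single_le_sum (f := fun i => (P.coeff i).natAbs) (fun _ _ => Nat.zero_le _) hi
  · simp [notMem_support_iff.1 hi]

lemma coeffSum_add_le (P Q : ℤ[X]) : coeffSum (P + Q) ≤ coeffSum P + coeffSum Q := by
  rw [coeffSum_eq_sum_of_subset (support_add (p := P) (q := Q)),
    coeffSum_eq_sum_of_subset (Finset.subset_union_left (s₁ := P.support) (s₂ := Q.support)),
    coeffSum_eq_sum_of_subset (Finset.subset_union_right (s₁ := P.support) (s₂ := Q.support)),
    ← Finset.sum_add_distrib]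
  exact Finset.sum_le_sum fun i _ => by rw [coeff_add]; exact Int.natAbs_add_le _ _

lemma coeffSum_neg (P : ℤ[X]) : coeffSum (-P) = coeffSum P := by simp [coeffSum]

lemma coeffSum_sub_le (P Q : ℤ[X]) : coeffSum (P - Q) ≤ coeffSum P + coeffSum Q := by
  rw [sub_eq_add_neg, ← coeffSum_neg Q]
  exact coeffSum_add_le _ _

@[simp] lemma coeffSum_zero : coeffSum 0 = 0 := by simp [coeffSum]

lemma coeffSum_sum_le {ι : Type*} (s : Finset ι) (P : ι → ℤ[X]) :
    coeffSum (∑ i ∈ s, P i) ≤ ∑ i ∈ s, coeffSum (P i) :=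
  Finset.le_sum_of_subadditive coeffSum coeffSum_zero.le coeffSum_add_le s P

lemma coeffSum_monomial_mul (n : ℕ) (c : ℤ) (P : ℤ[X]) :
    coeffSum (monomial n c * P) ≤ c.natAbs * coeffSum P := by
  have h : (monomial n c * P).support ⊆ P.support.map (addLeftEmbedding n) := by
    intro i hi
    rw [mem_support_iff, ← C_mul_X_pow_eq_monomial, mul_assoc, coeff_C_mul, coeff_X_pow_mul'] at hi
    rw [Finset.mem_map]
    split_ifs at hi with hni
    · exact ⟨i - n, mem_support_iff.2 fun h0 => hi (by rw [h0, mul_zero]), by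
        simp [Nat.add_sub_cancel' hni]⟩
    · exact absurd (mul_zero c) hi
  rw [coeffSum_eq_sum_of_subset h, Finset.sum_map, coeffSum, Finset.mul_sum]
  refine (Finset.sum_congr rfl fun i _ => ?_).le
  rw [addLeftEmbedding_apply, add_comm, coeff_monomial_mul, Int.natAbs_mul]

lemma coeffSum_mul_le (P Q : ℤ[X]) : coeffSum (P * Q) ≤ coeffSum P * coeffSum Q := by
  conv_lhs => rw [P.as_sum_support, Finset.sum_mul]
  refine (coeffSum_sum_le _ _).trans ?_
  rw [coeffSum, Finset.sum_mul]
  exact Finset.sum_le_sum fun i _ => coeffSum_monomial_mul _ _ _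

lemma coeffSum_monomial (n : ℕ) (c : ℤ) : coeffSum (monomial n c) = c.natAbs := by
  rw [coeffSum_eq_sum_of_subset (support_monomial_subset n c)]
  simp

lemma coeffSum_C (c : ℤ) : coeffSum (C c) = c.natAbs := coeffSum_monomial 0 c

lemma coeffSum_pow_le (P : ℤ[X]) (n : ℕ) : coeffSum (P ^ n) ≤ coeffSum P ^ n := by
  induction n with
  | zero => rw [pow_zero, ← C_1, coeffSum_C, pow_zero]; rfl
  | succ n ih =>
    rw [pow_succ, pow_succ]
    exact (coeffSum_mul_le _ _).trans (Nat.mul_le_mul_right _ ih)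

lemma coeffSum_comp_le (P Q : ℤ[X]) (hQ : 1 ≤ coeffSum Q) :
    coeffSum (P.comp Q) ≤ coeffSum P * coeffSum Q ^ P.natDegree := by
  rw [comp, eval₂_eq_sum, sum_def]
  refine (coeffSum_sum_le _ _).trans ?_
  rw [coeffSum, Finset.sum_mul]
  refine Finset.sum_le_sum fun i hi => (coeffSum_mul_le _ _).trans ?_
  rw [coeffSum_C]
  exact Nat.mul_le_mul_left _ ((coeffSum_pow_le _ _).trans
    (Nat.pow_le_pow_right hQ (le_natDegree_of_mem_supp _ hi)))

lemma one_le_coeffSum {P : ℤ[X]} (hP : P ≠ 0) : 1 ≤ coeffSum P :=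
  (Int.natAbs_pos.2 (leadingCoeff_ne_zero.2 hP)).trans_le (natAbs_coeff_le_coeffSum _ _)

/-- The polynomial part of a square root, after clearing denominators. -/
lemma exists_approx_sqrt {F : ℤ[X]} {e S : ℕ} {c : ℤ} (hc : c ≠ 0) (hdeg : F.natDegree ≤ 2 * e)
    (hlead : F.coeff (2 * e) = c ^ 2) (hS : 4 ≤ S) (hcS : c.natAbs ≤ S) (hFS : coeffSum F ≤ S)
    (m : ℕ) (hm : m ≤ e) : ∃ (M : ℤ) (H : ℤ[X]), M ≠ 0 ∧ H.natDegree ≤ e ∧ H.coeff e = M * c ∧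
      (∀ i, 2 * e - m ≤ i → (C (M ^ 2) * F - H ^ 2).coeff i = 0) ∧
      M.natAbs ≤ S ^ 4 ^ m ∧ coeffSum H ≤ S ^ 4 ^ m := by
  induction m with
  | zero =>
    refine ⟨1, monomial e c, one_ne_zero, natDegree_monomial_le _, by simp, fun i hi => ?_, ?_, ?_⟩
    · rw [sq (monomial e c), monomial_mul_monomial, coeff_sub, coeff_monomial, ← two_mul, one_pow,
        C_1, one_mul]
      rcases (show 2 * e ≤ i from hi).eq_or_lt with rfl | hi
      · simp [hlead, sq]
      · simp [hi.ne, coeff_eq_zero_of_natDegree_lt (hdeg.trans_lt hi)]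
    · simpa using by omega
    · simpa [coeffSum_monomial] using hcS
  | succ m ih =>
    obtain ⟨M, H, hM, hHd, hHc, hR, hMS, hHS⟩ := ih (by omega)
    set R := C (M ^ 2) * F - H ^ 2 with hRdef
    set r := R.coeff (2 * e - (m + 1)) with hr
    set B := S ^ 4 ^ m with hB
    have hSB : S ≤ B := Nat.le_self_pow (by positivity) S
    have hB4 : 4 ≤ B := hS.trans hSB
    have hrB : r.natAbs ≤ B ^ 2 * B + B ^ 2 := by
      refine (natAbs_coeff_le_coeffSum _ _).trans ((coeffSum_sub_le _ _).trans (add_le_add ?_ ?_))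
      · refine (coeffSum_mul_le _ _).trans ?_
        rw [coeffSum_C, Int.natAbs_pow]
        gcongr
        exact hFS.trans hSB
      · refine (coeffSum_pow_le _ _).trans ?_
        gcongr
    have hBB : S ^ 4 ^ (m + 1) = B ^ 4 := by rw [hB, ← pow_mul, pow_succ]
    have hb : 2 * B ^ 3 + (B ^ 2 * B + B ^ 2) ≤ B ^ 4 := by
      have : 4 * B ^ 3 ≤ B ^ 4 := by rw [pow_succ B 3, mul_comm]; gcongr
      have : B ^ 2 ≤ B ^ 3 := Nat.pow_le_pow_right (by omega) (by omega)
      have : B ^ 2 * B = B ^ 3 := by ring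
      omega
    have hb2 : 2 * B * B * B = 2 * B ^ 3 := by ring
    refine ⟨2 * M * c * M, C (2 * M * c) * H + monomial (e - (m + 1)) r, by positivity, ?_, ?_, ?_,
      ?_, ?_⟩
    · refine natDegree_add_le_of_degree_le ?_ ((natDegree_monomial_le _).trans (by omega))
      exact (natDegree_C_mul_le _ _).trans hHd
    · rw [coeff_add, coeff_C_mul, coeff_monomial, if_neg (by omega), hHc]
      ring
    · intro i hi
      have hexp : C ((2 * M * c * M) ^ 2) * F - (C (2 * M * c) * H + monomial (e - (m + 1)) r) ^ 2 =
          C ((2 * M * c) ^ 2) * R - C (2 * (2 * M * c)) * (monomial (e - (m + 1)) r * H) -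
            monomial (2 * (e - (m + 1))) (r ^ 2) := by
        rw [hRdef, mul_comm 2 (e - (m + 1)), ← monomial_pow, C_pow, C_pow, C_pow,
          C_mul (a := 2 * M * c) (b := M),
          C_mul (a := 2) (b := 2 * M * c)]
        simp only [C_ofNat]
        ring
      rw [hexp, coeff_sub, coeff_sub, coeff_C_mul, coeff_C_mul, coeff_monomial,
        if_neg (by omega), sub_zero]
      rcases (show 2 * e - (m + 1) ≤ i from hi).eq_or_lt with rfl | hi
      · rw [show 2 * e - (m + 1) = e + (e - (m + 1)) by omega, coeff_monomial_mul, hHc,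
          ← show 2 * e - (m + 1) = e + (e - (m + 1)) by omega, ← hr]
        ring
      · have h1 : (monomial (e - (m + 1)) r * H).coeff i = 0 := by
          refine coeff_eq_zero_of_natDegree_lt (lt_of_le_of_lt natDegree_mul_le ?_)
          have := natDegree_monomial_le r (m := e - (m + 1))
          omega
        rw [hR i (by omega), h1]
        ring
    · rw [hBB]
      simp only [Int.natAbs_mul]
      refine le_trans ?_ hb
      rw [← hb2]
      refine le_trans ?_ (Nat.le_add_right _ _)
      gcongr
      · rfl
      · exact hcS.trans hSB
    · rw [hBB]
      refine (coeffSum_add_le _ _).trans (le_trans (add_le_add ?_ ?_) hb)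
      · rw [← hb2]
        refine (coeffSum_mul_le _ _).trans ?_
        rw [coeffSum_C]
        simp only [Int.natAbs_mul]
        gcongr
        · rfl
        · exact hcS.trans hSB
      · rw [coeffSum_monomial]
        exact hrB

section LocalEstimates

variable {v : AbsoluteValue ℚ ℝ}

lemma abv_aeval_le (hv : ∀ n : ℤ, v n ≤ n.natAbs) {P : ℤ[X]} {n : ℕ} (hn : P.natDegree ≤ n) {x : ℚ}
    {r : ℝ} (hr : 1 ≤ r) (hx : v x ≤ r) : v (aeval x P) ≤ coeffSum P * r ^ n := by
  rw [aeval_eq_sum_range' (Nat.lt_succ_of_le hn), coeffSum_eq_sum_of_subset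
    (supp_subset_range (Nat.lt_succ_of_le hn)), Nat.cast_sum, Finset.sum_mul]
  refine (v.sum_le _ _).trans (Finset.sum_le_sum fun i hi => ?_)
  rw [zsmul_eq_mul, map_mul, map_pow]
  have hin : i ≤ n := Nat.lt_succ_iff.1 (Finset.mem_range.1 hi)
  exact mul_le_mul (hv _) ((pow_le_pow_left₀ (v.nonneg _) hx i).trans (pow_le_pow_right₀ hr hin))
    (by positivity) (Nat.cast_nonneg _)

lemma abv_aeval_sub_mul_le (hv : ∀ n : ℤ, v n ≤ n.natAbs) {P : ℤ[X]} {n : ℕ}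
    (hn : P.natDegree ≤ n) {x : ℚ} (hx : 1 ≤ v x) :
    v (aeval x P - P.coeff n * x ^ n) * v x ≤ coeffSum P * v x ^ n := by
  rw [aeval_eq_sum_range' (Nat.lt_succ_of_le hn), Finset.sum_range_succ, zsmul_eq_mul,
    add_sub_cancel_right, coeffSum_eq_sum_of_subset
    (supp_subset_range (Nat.lt_succ_of_le hn)), Nat.cast_sum, Finset.sum_range_succ, add_mul]
  refine le_add_of_le_of_nonneg ?_ (by positivity)
  rw [Finset.sum_mul]
  refine (mul_le_mul_of_nonneg_right (v.sum_le _ _) (v.nonneg _)).trans ?_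
  rw [Finset.sum_mul]
  refine Finset.sum_le_sum fun i hi => ?_
  rw [zsmul_eq_mul, map_mul, map_pow, mul_assoc, ← pow_succ]
  exact mul_le_mul (hv _) (pow_le_pow_right₀ hx (Finset.mem_range.1 hi))
    (by positivity) (Nat.cast_nonneg _)

/-- A polynomial is close to its leading term at a point of large absolute value. -/
lemma abv_aeval_div_sub_one_le (hv : ∀ n : ℤ, v n ≤ n.natAbs)
    (hv' : ∀ n : ℤ, n ≠ 0 → 1 ≤ v n * n.natAbs) {P : ℤ[X]} {n S : ℕ}
    (hn : P.natDegree ≤ n) (hc : P.coeff n ≠ 0) (hS : coeffSum P ≤ S) {x : ℚ} (hx : 1 ≤ v x)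
    {ε : ℝ} (hε : S ^ 2 ≤ ε * v x) :
    v (aeval x P / (P.coeff n * x ^ n) - 1) ≤ ε := by
  have hx0 : x ≠ 0 := fun h => by rw [h, map_zero] at hx; linarith
  have hc' : (P.coeff n : ℚ) ≠ 0 := by exact_mod_cast hc
  have hvc : 0 < v (P.coeff n : ℚ) := v.pos hc'
  have hvx : 0 < v x := by linarith
  rw [div_sub_one (by positivity), map_div₀, map_mul, map_pow, div_le_iff₀ (by positivity)]
  refine le_of_mul_le_mul_right ?_ hvx
  refine (abv_aeval_sub_mul_le hv hn hx).trans ?_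
  have h1 : (1 : ℝ) ≤ v (P.coeff n : ℚ) * S := (hv' _ hc).trans <|
    mul_le_mul_of_nonneg_left (by exact_mod_cast (natAbs_coeff_le_coeffSum P n).trans hS) hvc.le
  have h2 : (coeffSum P : ℝ) ≤ S := by exact_mod_cast hS
  calc (coeffSum P : ℝ) * v x ^ n ≤ S * v x ^ n := by gcongr
    _ ≤ (v (P.coeff n : ℚ) * S) * (S * v x ^ n) := le_mul_of_one_le_left (by positivity) h1
    _ = S ^ 2 * (v (P.coeff n : ℚ) * v x ^ n) := by ring
    _ ≤ ε * v x * (v (P.coeff n : ℚ) * v x ^ n) := by gcongr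
    _ = _ := by ring

lemma abv_sub_one_le_of_sq {δ : ℝ} (hδ : 0 ≤ δ) {t : ℚ} (ht : v (t ^ 2 - 1) ≤ δ ^ 2)
    (h : v (t - 1) ≤ v (t + 1)) : v (t - 1) ≤ δ := by
  refine abs_le_of_sq_le_sq' ?_ hδ |>.2
  calc v (t - 1) ^ 2 ≤ v (t - 1) * v (t + 1) := by
        rw [sq]; exact mul_le_mul_of_nonneg_left h (v.nonneg _)
    _ = v (t ^ 2 - 1) := by rw [← map_mul]; congr 1; ring
    _ ≤ δ ^ 2 := ht

lemma abv_mul_le_of_approx {ε : ℝ} {s t : ℚ} (hs : v (s - 1) ≤ ε)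
    (ht : v (t - 1) ≤ ε) : v (s * t - 1) ≤ 2 * ε + ε ^ 2 := by
  calc v (s * t - 1) = v ((s - 1) + (t - 1) + (s - 1) * (t - 1)) := by congr 1; ring
    _ ≤ v (s - 1) + v (t - 1) + v (s - 1) * v (t - 1) :=
      (v.add_le _ _).trans (add_le_add (v.add_le _ _) (map_mul v _ _).le)
    _ ≤ ε + ε + ε * ε := add_le_add (add_le_add hs ht)
      (mul_le_mul hs ht (v.nonneg _) ((v.nonneg _).trans hs))
    _ = _ := by ring

/-- Two approximate square roots of `1` with the same sign have product close to `1`. -/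
lemma abv_mul_sub_one_le_of_sq {δ : ℝ} (hδ : 0 ≤ δ) {s t : ℚ} (hs : v (s ^ 2 - 1) ≤ δ ^ 2)
    (ht : v (t ^ 2 - 1) ≤ δ ^ 2) (h : v (s - 1) ≤ v (s + 1) ↔ v (t - 1) ≤ v (t + 1)) :
    v (s * t - 1) ≤ 2 * δ + δ ^ 2 := by
  by_cases h1 : v (s - 1) ≤ v (s + 1)
  · exact abv_mul_le_of_approx (abv_sub_one_le_of_sq hδ hs h1) (abv_sub_one_le_of_sq hδ ht (h.1 h1))
  · have h2 : ¬ v (t - 1) ≤ v (t + 1) := fun h' => h1 (h.2 h')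
    have hneg : ∀ t : ℚ, v (t ^ 2 - 1) ≤ δ ^ 2 → ¬ v (t - 1) ≤ v (t + 1) → v (-t - 1) ≤ δ := by
      intro t ht h'
      refine abv_sub_one_le_of_sq hδ (by rwa [neg_sq]) ?_
      rw [← v.map_neg (-t - 1), ← v.map_neg (-t + 1), show -(-t - 1) = t + 1 by ring,
        show -(-t + 1) = t - 1 by ring]
      exact (not_le.1 h').le
    simpa using abv_mul_le_of_approx (hneg s hs h1) (hneg t ht h2)

lemma quarter_le_abv_add (hv2 : 1 / 2 ≤ v 2) {A B D h s t : ℚ} (hA : v (A - 1) ≤ 1 / 1200)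
    (hB : v (B - 1) ≤ 1 / 1200) (hD : v (D - 1) ≤ 1 / 1200) (hh : v (h - 1) ≤ 1 / 1200)
    (hs : s ^ 2 = A * B) (ht : t ^ 2 = A * D)
    (hst : v (s - 1) ≤ v (s + 1) ↔ v (t - 1) ≤ v (t + 1)) : 1 / 4 ≤ v (s * t / A + h) := by
  have h1 := abv_mul_sub_one_le_of_sq (v := v) (δ := 1 / 20) (by norm_num)
    (by rw [hs]; exact (abv_mul_le_of_approx hA hB).trans (by norm_num))
    (by rw [ht]; exact (abv_mul_le_of_approx hA hD).trans (by norm_num)) hst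
  have h2 := abv_mul_le_of_approx hA hh
  have hA0 : A ≠ 0 := by
    rintro rfl
    rw [zero_sub, v.map_neg, map_one] at hA
    norm_num at hA
  have hA1 : v A ≤ 1201 / 1200 := by
    have := v.add_le (A - 1) 1
    rw [sub_add_cancel, map_one] at this
    linarith
  have h3 : v 2 ≤ v (s * t + A * h) + v (s * t - 1) + v (A * h - 1) := by
    calc v 2 = v ((s * t + A * h) - (s * t - 1) - (A * h - 1)) := by congr 1; ring
      _ ≤ _ := (v.sub_le_add _ _).trans (add_le_add (v.sub_le_add _ _) le_rfl)
  have h4 : v (s * t + A * h) = v (s * t / A + h) * v A := by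
    rw [← map_mul]
    congr 1
    field_simp
  have h5 : v (s * t / A + h) * v A ≤ v (s * t / A + h) * (1201 / 1200) := by gcongr
  norm_num at h1 h2
  linarith

/-- If `M z` and `H(x)` have the same sign, where `z² = q_j(x) q_k(x)` and `H / M` is an
approximate square root of `q_j q_k`, then `M z` is close to `H(x)`. -/
lemma abv_approx_sqrt_sub_mul_le (hv : ∀ n : ℤ, v n ≤ n.natAbs)
    (hv' : ∀ n : ℤ, n ≠ 0 → 1 ≤ v n * n.natAbs) {qi qj qk H : ℤ[X]} {ni nj nk S S' : ℕ}
    {ci cj ck M : ℤ} (hci : ci ≠ 0) (hcj : cj ≠ 0) (hck : ck ≠ 0) (hM : M ≠ 0)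
    (hqi : qi.natDegree ≤ 2 * ni) (hqj : qj.natDegree ≤ 2 * nj) (hqk : qk.natDegree ≤ 2 * nk)
    (hli : qi.coeff (2 * ni) = ci ^ 2) (hlj : qj.coeff (2 * nj) = cj ^ 2)
    (hlk : qk.coeff (2 * nk) = ck ^ 2) (hSi : coeffSum qi ≤ S) (hSj : coeffSum qj ≤ S)
    (hSk : coeffSum qk ≤ S) (hH : H.natDegree ≤ nj + nk) (hlH : H.coeff (nj + nk) = M * (cj * ck))
    (hSH : coeffSum H ≤ S) (hR : (C (M ^ 2) * (qj * qk) - H ^ 2).natDegree + 1 ≤ nj + nk)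
    (hSR : coeffSum (C (M ^ 2) * (qj * qk) - H ^ 2) ≤ S')
    {x yj yk : ℚ} (hx1 : 1 ≤ v x) (hx : 1200 * S ^ 2 ≤ v x)
    (hyj : yj ^ 2 = aeval x qi * aeval x qj) (hyk : yk ^ 2 = aeval x qi * aeval x qk)
    (hsign : v (yj / (ci * cj * x ^ (ni + nj)) - 1) ≤ v (yj / (ci * cj * x ^ (ni + nj)) + 1) ↔
      v (yk / (ci * ck * x ^ (ni + nk)) - 1) ≤ v (yk / (ci * ck * x ^ (ni + nk)) + 1)) :
    v (M * (yj * yk / aeval x qi) - aeval x H) * v x ≤ 4 * S * S' := by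
  have hx0 : x ≠ 0 := fun h => by rw [h, map_zero] at hx1; linarith
  have hci' : (ci : ℚ) ≠ 0 := by exact_mod_cast hci
  have hcj' : (cj : ℚ) ≠ 0 := by exact_mod_cast hcj
  have hck' : (ck : ℚ) ≠ 0 := by exact_mod_cast hck
  have hM' : (M : ℚ) ≠ 0 := by exact_mod_cast hM
  have hε : (S : ℝ) ^ 2 ≤ 1 / 1200 * v x := by linarith
  have hA := abv_aeval_div_sub_one_le hv hv' hqi (by rw [hli]; positivity) hSi hx1 hε
  have hB := abv_aeval_div_sub_one_le hv hv' hqj (by rw [hlj]; positivity) hSj hx1 hε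
  have hD := abv_aeval_div_sub_one_le hv hv' hqk (by rw [hlk]; positivity) hSk hx1 hε
  have hh := abv_aeval_div_sub_one_le hv hv' hH (by rw [hlH]; positivity) hSH hx1 hε
  rw [hli] at hA
  rw [hlj] at hB
  rw [hlk] at hD
  have hv2 : (1 : ℝ) / 2 ≤ v 2 := by
    have := hv' 2 two_ne_zero
    norm_num at this
    linarith
  have hqi0 : aeval x qi ≠ 0 := by
    intro h0
    rw [h0, zero_div, zero_sub, v.map_neg, map_one] at hA
    norm_num at hA
  have hquart := quarter_le_abv_add hv2 hA hB hD hh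
    (s := yj / (ci * cj * x ^ (ni + nj))) (t := yk / (ci * ck * x ^ (ni + nk)))
    (by rw [div_pow, hyj]; push_cast; field_simp; ring)
    (by rw [div_pow, hyk]; push_cast; field_simp; ring) hsign
  rw [hlH] at hquart
  have hsum : M * (yj * yk / aeval x qi) + aeval x H = (M * (cj * ck) : ℤ) * x ^ (nj + nk) *
      (yj / (ci * cj * x ^ (ni + nj)) * (yk / (ci * ck * x ^ (ni + nk))) /
        (aeval x qi / ((ci ^ 2 : ℤ) * x ^ (2 * ni))) +
          aeval x H / ((M * (cj * ck) : ℤ) * x ^ (nj + nk))) := by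
    push_cast
    field_simp
    ring
  have hprod : (M * (yj * yk / aeval x qi) - aeval x H) * (M * (yj * yk / aeval x qi) + aeval x H) =
      aeval x (C (M ^ 2) * (qj * qk) - H ^ 2) := by
    have : (yj * yk / aeval x qi) ^ 2 = aeval x qj * aeval x qk := by
      rw [div_pow, mul_pow, hyj, hyk]
      field_simp
    simp only [map_sub, map_mul, map_pow, aeval_C, ← this]
    simp
    ring
  have hX : 0 < v x := by linarith
  have hplus : v x ^ (nj + nk) ≤ 4 * S * v (M * (yj * yk / aeval x qi) + aeval x H) := by
    have h1 : (1 : ℝ) ≤ v ((M * (cj * ck) : ℤ) : ℚ) * S :=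
      (hv' (M * (cj * ck)) (by positivity)).trans <| by
      rw [← hlH]
      have : ((H.coeff (nj + nk)).natAbs : ℝ) ≤ S := by
        exact_mod_cast (natAbs_coeff_le_coeffSum H _).trans hSH
      exact mul_le_mul_of_nonneg_left this (v.nonneg _)
    rw [hsum, map_mul, map_mul, map_pow]
    calc v x ^ (nj + nk) ≤ (v ((M * (cj * ck) : ℤ) : ℚ) * S) * v x ^ (nj + nk) :=
          le_mul_of_one_le_left (by positivity) h1
      _ = 4 * S * (v ((M * (cj * ck) : ℤ) : ℚ) * v x ^ (nj + nk) * (1 / 4)) := by ring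
      _ ≤ _ := by gcongr
  have hRx : v (aeval x (C (M ^ 2) * (qj * qk) - H ^ 2)) * v x ≤ S' * v x ^ (nj + nk) := by
    obtain ⟨m, hm⟩ : ∃ m, nj + nk = m + 1 := ⟨nj + nk - 1, by omega⟩
    have h1 := abv_aeval_le hv (n := m) (by omega) hx1 le_rfl
      (P := C (M ^ 2) * (qj * qk) - H ^ 2)
    have h2 : (coeffSum (C (M ^ 2) * (qj * qk) - H ^ 2) : ℝ) ≤ S' := by exact_mod_cast hSR
    calc _ ≤ S' * v x ^ m * v x :=
          mul_le_mul_of_nonneg_right (h1.trans (by gcongr)) hX.le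
      _ = _ := by rw [hm, pow_succ, mul_assoc]
  refine le_of_mul_le_mul_right ?_ (pow_pos hX (nj + nk))
  calc _ ≤ v (M * (yj * yk / aeval x qi) - aeval x H) * v x *
        (4 * S * v (M * (yj * yk / aeval x qi) + aeval x H)) :=
        mul_le_mul_of_nonneg_left hplus (by positivity)
    _ = 4 * S * (v (aeval x (C (M ^ 2) * (qj * qk) - H ^ 2)) * v x) := by
        rw [← hprod, map_mul]; ring
    _ ≤ 4 * S * (S' * v x ^ (nj + nk)) := by gcongr
    _ = _ := by ring

end LocalEstimates

section Places

lemma prod_padicNorm_natCast {n : ℕ} (hn : n ≠ 0) {s : Finset ℕ} (hs : ∀ p ∈ s, p.Prime)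
    (hns : n.primeFactors ⊆ s) : ∏ p ∈ s, padicNorm p n = (n : ℚ)⁻¹ := by
  conv_rhs => rw [← Nat.prod_factorization_pow_eq_self hn,
    Nat.prod_factorization_eq_prod_primeFactors]
  rw [Nat.cast_prod, ← Finset.prod_inv_distrib]
  symm
  refine (Finset.prod_subset hns fun p hp hpn => ?_).trans (Finset.prod_congr rfl fun p hp => ?_)
  · rw [Finsupp.notMem_support_iff.1 hpn, pow_zero, Nat.cast_one, inv_one]
  · rw [padicNorm.eq_zpow_of_nonzero (Nat.cast_ne_zero.2 hn), padicValRat.of_nat,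
      Nat.factorization_def _ (hs p hp), zpow_neg, zpow_natCast, Nat.cast_pow]

lemma inv_le_prod_padicNorm_natCast {n : ℕ} (hn : n ≠ 0) {s : Finset ℕ}
    (hs : ∀ p ∈ s, p.Prime) : (n : ℚ)⁻¹ ≤ ∏ p ∈ s, padicNorm p n := by
  rw [← prod_padicNorm_natCast hn (s := s ∪ n.primeFactors)
    (fun p hp => (Finset.mem_union.1 hp).elim (hs p) Nat.prime_of_mem_primeFactors)
    Finset.subset_union_right]
  refine Finset.prod_le_prod_of_subset_of_le_one Finset.subset_union_left
    (fun p _ => padicNorm.nonneg _) fun p hp _ => ?_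
  have := Fact.mk (((Finset.mem_union.1 hp).elim (hs p) Nat.prime_of_mem_primeFactors))
  exact padicNorm.of_nat n

lemma padicNorm_natAbs (p : ℕ) (n : ℤ) : padicNorm p n.natAbs = padicNorm p n := by
  rw [Nat.cast_natAbs]
  rcases abs_choice n with h | h <;> rw [h]
  rw [Int.cast_neg, padicNorm.neg]

/-- The absolute value on `ℚ` attached to `p`: the `p`-adic one if `p` is prime, and the real one
otherwise. -/
noncomputable def place (p : ℕ) : AbsoluteValue ℚ ℝ :=
  open Classical in
  if h : p.Prime then haveI := Fact.mk h; Rat.AbsoluteValue.padic p else Rat.AbsoluteValue.real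

lemma place_of_prime {p : ℕ} (hp : p.Prime) (x : ℚ) : place p x = padicNorm p x := by
  rw [place, dif_pos hp]
  rfl

lemma place_of_not_prime {p : ℕ} (hp : ¬ p.Prime) (x : ℚ) : place p x = |x| := by
  rw [place, dif_neg hp, Rat.AbsoluteValue.real_eq_abs]

lemma place_intCast_le (p : ℕ) (n : ℤ) : place p n ≤ n.natAbs := by
  rw [Nat.cast_natAbs]
  by_cases hp : p.Prime
  · have := Fact.mk hp
    rw [place_of_prime hp]
    rcases eq_or_ne n 0 with rfl | hn
    · simp
    · calc ((padicNorm p n : ℚ) : ℝ) ≤ 1 := by exact_mod_cast padicNorm.of_int n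
        _ ≤ _ := by exact_mod_cast Int.one_le_abs hn
  · rw [place_of_not_prime hp]
    simp

lemma one_le_place_mul_natAbs (p : ℕ) (n : ℤ) (hn : n ≠ 0) : 1 ≤ place p n * n.natAbs := by
  have h0 : 0 < n.natAbs := Int.natAbs_pos.2 hn
  by_cases hp : p.Prime
  · rw [place_of_prime hp]
    have h1 := inv_le_prod_padicNorm_natCast h0.ne' (s := {p}) (by simpa using hp)
    rw [Finset.prod_singleton, inv_le_iff_one_le_mul₀ (by exact_mod_cast h0)] at h1
    rw [padicNorm_natAbs] at h1
    exact_mod_cast h1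
  · rw [place_of_not_prime hp]
    have : (1 : ℝ) ≤ n.natAbs := by exact_mod_cast h0
    have h3 : ((|(n : ℚ)| : ℚ) : ℝ) = n.natAbs := by simp [Nat.cast_natAbs]
    rw [h3]
    nlinarith

/-- The ring `ℤ[1/a]`, as the rationals that are integral at the primes not dividing `a`. -/
def awayIntegers (a : ℤ) : Subring ℚ where
  carrier := {x | ∀ p : ℕ, p.Prime → ¬ (p : ℤ) ∣ a → padicNorm p x ≤ 1}
  mul_mem' {x y} hx hy p hp hpa := by
    have := Fact.mk hp
    rw [padicNorm.mul]
    exact mul_le_one₀ (hx p hp hpa) (padicNorm.nonneg _) (hy p hp hpa)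
  one_mem' p hp _ := by simp
  add_mem' {x y} hx hy p hp hpa := by
    have := Fact.mk hp
    exact padicNorm.nonarchimedean.trans (max_le (hx p hp hpa) (hy p hp hpa))
  zero_mem' p hp _ := by simp
  neg_mem' {x} hx p hp hpa := by
    rw [padicNorm.neg]
    exact hx p hp hpa

lemma mem_awayIntegers_of_sq_mem {a : ℤ} {x : ℚ} (h : x ^ 2 ∈ awayIntegers a) :
    x ∈ awayIntegers a := by
  intro p hp hpa
  have := Fact.mk hp
  have h1 := h p hp hpa
  rw [sq, padicNorm.mul, ← sq] at h1
  exact (sq_le_one_iff₀ (padicNorm.nonneg _)).1 h1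

lemma div_mem_awayIntegers (a b : ℤ) : (b / a : ℚ) ∈ awayIntegers a := by
  intro p hp hpa
  have := Fact.mk hp
  rw [padicNorm.div, (padicNorm.int_eq_one_iff a).2 hpa, div_one]
  exact padicNorm.of_int b

lemma aeval_mem_awayIntegers {a : ℤ} {x : ℚ} (hx : x ∈ awayIntegers a) (P : ℤ[X]) :
    aeval x P ∈ awayIntegers a := by
  rw [aeval_eq_sum_range]
  exact sum_mem fun i _ => zsmul_mem (pow_mem hx i) _

lemma padicNorm_den {p : ℕ} (hp : p.Prime) {x : ℚ} (h : p ∣ x.den) :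
    padicNorm p x = (padicNorm p x.den)⁻¹ := by
  have := Fact.mk hp
  have h1 : padicNorm p x.num = 1 := by
    rw [padicNorm.int_eq_one_iff]
    intro h2
    have := Nat.dvd_gcd (Int.natCast_dvd.1 h2) h
    rw [x.reduced] at this
    exact hp.one_lt.ne' (Nat.dvd_one.1 this)
  conv_lhs => rw [← Rat.num_div_den x, padicNorm.div, h1, one_div]

lemma primeFactors_den_subset {a : ℤ} (ha : a ≠ 0) {x : ℚ} (hx : x ∈ awayIntegers a) :
    x.den.primeFactors ⊆ a.natAbs.primeFactors := by
  intro p hp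
  rw [Nat.mem_primeFactors] at hp ⊢
  have := Fact.mk hp.1
  refine ⟨hp.1, ?_, Int.natAbs_ne_zero.2 ha⟩
  by_contra h
  have h1 := hx p hp.1 fun h' => h (Int.natCast_dvd.1 h')
  rw [padicNorm_den hp.1 hp.2.1] at h1
  have h2 : padicNorm p x.den < 1 := (padicNorm.nat_lt_one_iff _).2 hp.2.1
  have h3 : padicNorm p x.den ≠ 0 := padicNorm.nonzero (by exact_mod_cast x.den_ne_zero)
  exact absurd h1 (not_le.2 ((one_lt_inv₀ ((padicNorm.nonneg _).lt_of_ne' h3)).2 h2))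

/-- The primes dividing `a`, and `0` for the real place. -/
def places (a : ℤ) : Finset ℕ := insert 0 a.natAbs.primeFactors

lemma prod_places {a : ℤ} (F : ℕ → ℝ) :
    ∏ p ∈ places a, F p = F 0 * ∏ p ∈ a.natAbs.primeFactors, F p :=
  Finset.prod_insert fun h => Nat.not_prime_zero (Nat.prime_of_mem_primeFactors h)

lemma one_le_prod_place {a : ℤ} (ha : a ≠ 0) {x : ℚ} (hx : x ∈ awayIntegers a) (hx0 : x ≠ 0) :
    1 ≤ ∏ p ∈ places a, place p x := by
  have hs : ∀ p ∈ a.natAbs.primeFactors, p.Prime := fun p => Nat.prime_of_mem_primeFactors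
  rw [prod_places, place_of_not_prime Nat.not_prime_zero,
    Finset.prod_congr rfl fun p hp => place_of_prime (hs p hp) x]
  have h1 := inv_le_prod_padicNorm_natCast
    (Int.natAbs_ne_zero.2 (Rat.num_ne_zero.2 hx0)) hs
  have h2 := prod_padicNorm_natCast x.den_ne_zero hs (primeFactors_den_subset ha hx)
  have h3 : ∏ p ∈ a.natAbs.primeFactors, padicNorm p x =
      (∏ p ∈ a.natAbs.primeFactors, padicNorm p x.num.natAbs) * x.den := by
    rw [← inv_inv (x.den : ℚ), ← h2, ← div_eq_mul_inv, ← Finset.prod_div_distrib]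
    refine Finset.prod_congr rfl fun p hp => ?_
    have := Fact.mk (hs p hp)
    rw [padicNorm_natAbs, ← padicNorm.div, Rat.num_div_den]
  have h4 : |x| = x.num.natAbs / x.den := by
    conv_lhs => rw [← Rat.num_div_den x, abs_div]
    rw [Nat.cast_natAbs, Int.cast_abs, Nat.abs_cast]
  have hn : (0 : ℚ) < x.num.natAbs := by
    exact_mod_cast Int.natAbs_pos.2 (Rat.num_ne_zero.2 hx0)
  have hd : (0 : ℚ) < x.den := by exact_mod_cast x.den_pos
  have : (1 : ℚ) ≤ |x| * ∏ p ∈ a.natAbs.primeFactors, padicNorm p x := by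
    rw [h3, h4, div_mul_eq_mul_div, ← mul_assoc, mul_div_cancel_right₀ _ hd.ne']
    rw [inv_le_iff_one_le_mul₀ hn] at h1
    linarith
  exact_mod_cast this

/-- There are finitely many elements of `ℤ[1/a]` of bounded height. -/
lemma finite_setOf_place_le {a : ℤ} (ha : a ≠ 0) (r : ℕ) :
    {x : ℚ | x ∈ awayIntegers a ∧ ∀ p ∈ places a, place p x ≤ r}.Finite := by
  set s := a.natAbs.primeFactors with hsdef
  set N := (r + 1) ^ s.card with hN
  have hs : ∀ p ∈ s, p.Prime := fun p => Nat.prime_of_mem_primeFactors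
  refine Set.Finite.subset ((Set.finite_Icc (-(r * N : ℕ) : ℤ) (r * N : ℕ)).image2
    (fun (n : ℤ) (d : ℕ) => (n / d : ℚ)) (Set.finite_Icc 0 N)) ?_
  rintro x ⟨hx, hxr⟩
  have h2 := prod_padicNorm_natCast x.den_ne_zero hs (primeFactors_den_subset ha hx)
  have hden : (x.den : ℚ) ≤ N := by
    rw [← inv_inv (x.den : ℚ), ← h2, ← Finset.prod_inv_distrib, hN, Nat.cast_pow]
    refine (Finset.prod_le_prod (fun p _ => inv_nonneg.2 (padicNorm.nonneg _))
      (g := fun _ => ((r + 1 : ℕ) : ℚ)) fun p hp => ?_).trans_eq (Finset.prod_const _)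
    have := Fact.mk (hs p hp)
    by_cases hpd : p ∣ x.den
    · rw [← padicNorm_den (hs p hp) hpd]
      have := hxr p (Finset.mem_insert_of_mem hp)
      rw [place_of_prime (hs p hp)] at this
      have h : padicNorm p x ≤ r := by exact_mod_cast this
      push_cast
      linarith
    · rw [(padicNorm.nat_eq_one_iff _).2 hpd]
      simp
  have hden' : x.den ≤ N := by exact_mod_cast hden
  refine ⟨x.num, ?_, x.den, ⟨Nat.zero_le _, hden'⟩, Rat.num_div_den x⟩
  have h0 := hxr 0 (Finset.mem_insert_self _ _)
  rw [place_of_not_prime Nat.not_prime_zero] at h0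
  have h0' : |x| ≤ r := by exact_mod_cast h0
  have hnum : |(x.num : ℚ)| ≤ (r * N : ℕ) := by
    have h : (x.num : ℚ) = x * x.den := (Rat.mul_den_eq_num x).symm
    rw [h, abs_mul, Nat.abs_cast, Nat.cast_mul]
    gcongr
  rw [Set.mem_Icc, ← abs_le]
  exact_mod_cast hnum

end Places

section Escape

lemma abv_sq_le_of_le {v : AbsoluteValue ℚ ℝ} (hv : ∀ n : ℤ, v n ≤ n.natAbs)
    (hv' : ∀ n : ℤ, n ≠ 0 → 1 ≤ v n * n.natAbs) {f : ℤ[X]} (hdeg : 2 ≤ f.natDegree) {x : ℚ}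
    (hx : 4 * (coeffSum f : ℝ) ^ 2 ≤ v x) : v x ^ 2 ≤ 2 * coeffSum f * v (aeval x f) := by
  have hf : f ≠ 0 := by rintro rfl; simp at hdeg
  have hA : (1 : ℝ) ≤ coeffSum f := by exact_mod_cast one_le_coeffSum hf
  have hx1 : 1 ≤ v x := by nlinarith
  have hx0 : x ≠ 0 := fun h => by rw [h, map_zero] at hx1; linarith
  have hc : f.coeff f.natDegree ≠ 0 := leadingCoeff_ne_zero.2 hf
  have hc' : (f.coeff f.natDegree : ℚ) ≠ 0 := by exact_mod_cast hc
  have h1 := abv_aeval_div_sub_one_le hv hv' le_rfl hc le_rfl hx1 (ε := 1 / 2) (by linarith)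
  have h2 : 1 / 2 ≤ v (aeval x f / (f.coeff f.natDegree * x ^ f.natDegree)) := by
    have := v.sub_le_add (aeval x f / (f.coeff f.natDegree * x ^ f.natDegree))
      (aeval x f / (f.coeff f.natDegree * x ^ f.natDegree) - 1)
    rw [sub_sub_cancel, map_one] at this
    linarith
  have h3 : 0 < v (f.coeff f.natDegree : ℚ) := v.pos hc'
  rw [map_div₀, map_mul, map_pow, le_div_iff₀ (by positivity)] at h2
  have h4 : 1 ≤ v (f.coeff f.natDegree : ℚ) * coeffSum f := (hv' _ hc).trans <|
    mul_le_mul_of_nonneg_left (by exact_mod_cast natAbs_coeff_le_coeffSum f _) h3.le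
  calc v x ^ 2 ≤ v x ^ f.natDegree := pow_le_pow_right₀ hx1 hdeg
    _ ≤ (v (f.coeff f.natDegree : ℚ) * coeffSum f) * v x ^ f.natDegree :=
      le_mul_of_one_le_left (by positivity) h4
    _ = 2 * coeffSum f * (1 / 2 * (v (f.coeff f.natDegree : ℚ) * v x ^ f.natDegree)) := by ring
    _ ≤ _ := by gcongr

lemma two_pow_two_pow_le_abv {v : AbsoluteValue ℚ ℝ} (hv : ∀ n : ℤ, v n ≤ n.natAbs)
    (hv' : ∀ n : ℤ, n ≠ 0 → 1 ≤ v n * n.natAbs) {f : ℤ[X]} (hdeg : 2 ≤ f.natDegree) {x : ℚ}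
    (hx : 4 * (coeffSum f : ℝ) ^ 2 ≤ v x) (t : ℕ) :
    (2 : ℝ) ^ 2 ^ t ≤ v (aeval x (polyIter f t)) := by
  have hf : f ≠ 0 := by rintro rfl; simp at hdeg
  have hA : (1 : ℝ) ≤ coeffSum f := by exact_mod_cast one_le_coeffSum hf
  suffices h : 4 * (coeffSum f : ℝ) ^ 2 ≤ v (aeval x (polyIter f t)) ∧
      2 * coeffSum f * (2 : ℝ) ^ 2 ^ t ≤ v (aeval x (polyIter f t)) by
    refine le_trans ?_ h.2
    exact le_mul_of_one_le_left (by positivity) (by linarith)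
  induction t with
  | zero =>
    simp only [polyIter, aeval_X]
    exact ⟨hx, le_trans (by norm_num; nlinarith) hx⟩
  | succ t ih =>
    have h1 := abv_sq_le_of_le hv hv' hdeg ih.1
    rw [polyIter, aeval_comp]
    set y := v (aeval x (polyIter f t))
    set y' := v (aeval (aeval x (polyIter f t)) f)
    have h2 : (2 * coeffSum f * (2 : ℝ) ^ 2 ^ t) ^ 2 ≤ 2 * coeffSum f * y' :=
      (pow_le_pow_left₀ (by positivity) ih.2 2).trans h1
    have h3 : 2 * coeffSum f * (2 : ℝ) ^ 2 ^ (t + 1) ≤ y' := by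
      refine le_of_mul_le_mul_left ?_ (show (0 : ℝ) < 2 * coeffSum f by linarith)
      refine le_trans (le_of_eq ?_) h2
      rw [pow_succ 2 t, pow_mul]
      ring
    have h4 : 4 * (coeffSum f : ℝ) ^ 2 ≤ y' := by
      refine le_of_mul_le_mul_left ?_ (show (0 : ℝ) < 2 * coeffSum f by linarith)
      refine le_trans ?_ h1
      calc _ ≤ (4 * (coeffSum f : ℝ) ^ 2) ^ 2 := by
            nlinarith [pow_pos (show (0 : ℝ) < coeffSum f by linarith) 3]
        _ ≤ y ^ 2 := pow_le_pow_left₀ (by positivity) ih.1 2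
    exact ⟨h4, h3⟩

lemma neg_div_mem_awayIntegers (a b : ℤ) : (-(b : ℚ) / a) ∈ awayIntegers a := by
  exact_mod_cast div_mem_awayIntegers a (-b)

/-- If `-b / a` is not pre-periodic, then its orbit tends to infinity at some of the places in
`places a`, and it is bounded at the other ones. -/
lemma exists_escaping_places {f : ℤ[X]} (hdeg : 2 ≤ f.natDegree) {a b : ℤ} (ha : a ≠ 0)
    (hγ : ¬ IsPreperiodicPt f (-(b : ℚ) / a)) : ∃ (E : Finset ℕ) (n₀ r : ℕ), E ⊆ places a ∧
      E.Nonempty ∧ 1 ≤ r ∧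
      (∀ p ∈ E, ∀ t, (2 : ℝ) ^ 2 ^ t ≤ place p (aeval (-(b : ℚ) / a) (polyIter f (n₀ + t)))) ∧
      ∀ p ∈ places a, p ∉ E → ∀ n, place p (aeval (-(b : ℚ) / a) (polyIter f n)) ≤ r := by
  classical
  have hf : f ≠ 0 := by rintro rfl; simp at hdeg
  set u : ℕ → ℚ := fun n => aeval (-(b : ℚ) / a) (polyIter f n) with hu
  set r := 4 * coeffSum f ^ 2 with hr
  have hr' : (r : ℝ) = 4 * (coeffSum f : ℝ) ^ 2 := by rw [hr]; push_cast; ring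
  have hr1 : 1 ≤ r := by
    have := Nat.pow_le_pow_left (one_le_coeffSum hf) 2
    omega
  have hE : ∀ p : ℕ, ∃ n, (∃ m, (r : ℝ) ≤ place p (u m)) → (r : ℝ) ≤ place p (u n) := fun p => by
    by_cases h : ∃ m, (r : ℝ) ≤ place p (u m)
    · exact ⟨h.choose, fun _ => h.choose_spec⟩
    · exact ⟨0, fun h' => (h h').elim⟩
  choose N hN using hE
  refine ⟨(places a).filter fun p => ∃ m, (r : ℝ) ≤ place p (u m), (places a).sup N, r,
    Finset.filter_subset _ _, ?_, hr1, ?_, ?_⟩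
  · by_contra hne
    rw [Finset.not_nonempty_iff_eq_empty, Finset.filter_eq_empty_iff] at hne
    push Not at hne
    refine hγ ((finite_setOf_place_le ha r).subset ?_)
    rintro x ⟨n, -, rfl⟩
    exact ⟨aeval_mem_awayIntegers (neg_div_mem_awayIntegers a b) _, fun p hp => (hne hp n).le⟩
  · intro p hp t
    rw [Finset.mem_filter] at hp
    obtain ⟨s, hs⟩ := Nat.exists_eq_add_of_le (Finset.le_sup (f := N) hp.1)
    have h1 := two_pow_two_pow_le_abv (place_intCast_le p) (one_le_place_mul_natAbs p) hdeg
      (hr' ▸ hN p hp.2) (s + t)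
    rw [show (places a).sup N + t = s + t + N p by omega, polyIter_add, aeval_comp]
    exact (pow_le_pow_right₀ one_le_two (Nat.pow_le_pow_right two_pos (by omega))).trans h1
  · intro p hp hpE n
    rw [Finset.mem_filter] at hpE
    push Not at hpE
    exact (hpE hp n).le

end Escape

section SquareClasses

/-- Runge's method: an element `x` of `ℤ[1/a]` that is large at the places in `E` and bounded at
the other ones does not give square values of `qi qj` and `qi qk` having the same signs, unless
`qj qk` is a square. -/
lemma square_mul_of_same_signs {a : ℤ} (ha : a ≠ 0) {x : ℚ} (hx : x ∈ awayIntegers a)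
    {E : Finset ℕ} (hE : E ⊆ places a) (hEne : E.Nonempty) {S S₁ e r : ℕ} {B : ℝ} (he : 1 ≤ e)
    (hr : 1 ≤ r) (hS : 2 ≤ S) (hS₁ : S₁ = (S ^ 2) ^ 4 ^ (2 * e))
    (hB : (4 * (S₁ : ℝ) ^ 8 * r ^ (2 * e)) ^ (places a).card < B)
    (hxE : ∀ p ∈ E, B ≤ place p x) (hxr : ∀ p ∈ places a, p ∉ E → place p x ≤ r)
    {qi qj qk : ℤ[X]} {ci cj ck : ℤ} {ni nj nk : ℕ} (hci : ci ≠ 0) (hcj : cj ≠ 0) (hck : ck ≠ 0)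
    (hnj : nj ≤ e) (hnk : nk ≤ e)
    (hqi : qi.natDegree ≤ 2 * ni) (hqj : qj.natDegree ≤ 2 * nj) (hqk : qk.natDegree ≤ 2 * nk)
    (hli : qi.coeff (2 * ni) = ci ^ 2) (hlj : qj.coeff (2 * nj) = cj ^ 2)
    (hlk : qk.coeff (2 * nk) = ck ^ 2) (hSi : coeffSum qi ≤ S) (hSj : coeffSum qj ≤ S)
    (hSk : coeffSum qk ≤ S) (hTj : cj.natAbs ≤ S) (hTk : ck.natAbs ≤ S) {yj yk : ℚ}
    (hyj : yj ^ 2 = aeval x qi * aeval x qj) (hyk : yk ^ 2 = aeval x qi * aeval x qk)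
    (hsign : ∀ p ∈ E, (place p (yj / (ci * cj * x ^ (ni + nj)) - 1) ≤
      place p (yj / (ci * cj * x ^ (ni + nj)) + 1) ↔
      place p (yk / (ci * ck * x ^ (ni + nk)) - 1) ≤
      place p (yk / (ci * ck * x ^ (ni + nk)) + 1))) :
    ∃ (M : ℤ) (H : ℤ[X]), M ≠ 0 ∧ C (M ^ 2) * (qj * qk) = H ^ 2 := by
  have hS2 : 4 ≤ S ^ 2 := by nlinarith
  have hSS : S ^ 2 ≤ S₁ := by
    rw [hS₁]; exact Nat.le_self_pow (by positivity) _
  have hS₁16 : 16 ≤ S₁ := by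
    rw [hS₁]
    calc 16 ≤ 4 ^ 4 ^ (2 * 1) := by norm_num
      _ ≤ (S ^ 2) ^ 4 ^ (2 * e) := pow_le_pow hS2 (by omega)
        (Nat.pow_le_pow_right (by norm_num) (by omega))
  obtain ⟨M, H, hM, hH, hlH, hR, hMS, hHS⟩ := exists_approx_sqrt (F := qj * qk) (e := nj + nk)
    (S := S ^ 2) (c := cj * ck) (mul_ne_zero hcj hck)
    (by rw [mul_add]; exact natDegree_mul_le.trans (add_le_add hqj hqk))
    (by rw [mul_add, coeff_mul_add_eq_of_natDegree_le hqj hqk, hlj, hlk]; ring) hS2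
    (by rw [Int.natAbs_mul, sq]; exact Nat.mul_le_mul hTj hTk)
    (by rw [sq]; exact (coeffSum_mul_le _ _).trans (Nat.mul_le_mul hSj hSk)) (nj + nk) le_rfl
  have hpow : (S ^ 2) ^ 4 ^ (nj + nk) ≤ S₁ := by
    rw [hS₁]
    exact Nat.pow_le_pow_right (by omega) (Nat.pow_le_pow_right (by norm_num) (by omega))
  replace hMS := hMS.trans hpow
  replace hHS := hHS.trans hpow
  refine ⟨M, H, hM, ?_⟩
  by_contra hne
  set R := C (M ^ 2) * (qj * qk) - H ^ 2 with hRdef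
  have hR0 : R ≠ 0 := sub_ne_zero.2 hne
  have hRdeg : R.natDegree + 1 ≤ nj + nk := by
    rw [Nat.succ_le_iff, natDegree_lt_iff_degree_lt hR0, degree_lt_iff_coeff_zero]
    intro i hi
    exact hR i (by omega)
  have hRS : coeffSum R ≤ S₁ ^ 4 := by
    have h1 : coeffSum (C (M ^ 2) * (qj * qk)) ≤ S₁ ^ 2 * S₁ := by
      refine (coeffSum_mul_le _ _).trans (Nat.mul_le_mul ?_ ?_)
      · rw [coeffSum_C, Int.natAbs_pow]
        exact Nat.pow_le_pow_left hMS 2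
      · exact ((coeffSum_mul_le _ _).trans (Nat.mul_le_mul hSj hSk)).trans (by rwa [← sq])
    have h2 : coeffSum (H ^ 2) ≤ S₁ ^ 2 := (coeffSum_pow_le _ _).trans (Nat.pow_le_pow_left hHS 2)
    refine (coeffSum_sub_le _ _).trans ((add_le_add h1 h2).trans ?_)
    nlinarith [pow_pos (show 0 < S₁ by omega) 2, pow_pos (show 0 < S₁ by omega) 3]
  have hS₁' : (16 : ℝ) ≤ S₁ := by exact_mod_cast hS₁16
  have hSS' : (S : ℝ) ^ 2 ≤ S₁ := by exact_mod_cast hSS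
  have hS' : (2 : ℝ) ≤ S := by exact_mod_cast hS
  have hr' : (1 : ℝ) ≤ r := by exact_mod_cast hr
  set G : ℝ := 4 * (S₁ : ℝ) ^ 8 * r ^ (2 * e) with hG
  have hr2 : (1 : ℝ) ≤ r ^ (2 * e) := one_le_pow₀ hr'
  have hS₁7 : (1 : ℝ) ≤ (S₁ : ℝ) ^ 3 := one_le_pow₀ (by linarith)
  have hG8 : 4 * (S₁ : ℝ) ^ 8 ≤ G := le_mul_of_one_le_right (by positivity) hr2
  have hG1 : 1 ≤ G :=
    le_trans (by linarith [one_le_pow₀ (show (1 : ℝ) ≤ S₁ by linarith) (n := 8)]) hG8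
  have hcard : (places a).card ≠ 0 := Finset.card_ne_zero.2 (hEne.mono hE)
  have hGB : G < B := (le_self_pow₀ hG1 hcard).trans_lt hB
  have hxE1 : ∀ p ∈ E, 1 ≤ place p x := fun p hp => (hG1.trans hGB.le).trans (hxE p hp)
  have hbig : ∀ p ∈ E, 2 * (S₁ : ℝ) ^ 8 ≤ place p x := fun p hp => by
    have := hxE p hp
    linarith [pow_pos (show (0 : ℝ) < S₁ by linarith) 8]
  have hbig' : ∀ p ∈ E, 1200 * (S₁ : ℝ) ^ 2 ≤ place p x := fun p hp => by
    refine le_trans ?_ (hbig p hp)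
    have h6 : (16 : ℝ) ^ 6 ≤ (S₁ : ℝ) ^ 6 := pow_le_pow_left₀ (by norm_num) hS₁' 6
    have : (S₁ : ℝ) ^ 8 = (S₁ : ℝ) ^ 6 * (S₁ : ℝ) ^ 2 := by ring
    rw [this, ← mul_assoc]
    gcongr
    linarith
  have hSS₁ : S ≤ S₁ := le_trans (Nat.le_self_pow two_ne_zero S) hSS
  obtain ⟨p₀, hp₀⟩ := hEne
  have hne_zero : ∀ {P : ℤ[X]} {n : ℕ}, P.natDegree ≤ n → P.coeff n ≠ 0 → coeffSum P ≤ S₁ ^ 4 →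
      aeval x P ≠ 0 := by
    intro P n hn hc hP h0
    have h1 := abv_aeval_div_sub_one_le (place_intCast_le p₀) (one_le_place_mul_natAbs p₀) hn hc hP
      (hxE1 p₀ hp₀) (ε := 1 / 2) (by
        have := hbig p₀ hp₀
        push_cast
        rw [← pow_mul]
        linarith)
    rw [h0, zero_div, zero_sub, AbsoluteValue.map_neg, map_one] at h1
    norm_num at h1
  have hqi0 : aeval x qi ≠ 0 := hne_zero hqi (by rw [hli]; positivity)
    (hSi.trans (hSS₁.trans (Nat.le_self_pow (by norm_num) _)))
  have hRx : aeval x R ≠ 0 := hne_zero le_rfl (leadingCoeff_ne_zero.2 hR0) hRS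
  set z := yj * yk / aeval x qi with hz
  have hz2 : z ^ 2 = aeval x (qj * qk) := by
    rw [hz, div_pow, mul_pow, hyj, hyk, map_mul]
    field_simp
  have hzmem : z ∈ awayIntegers a := mem_awayIntegers_of_sq_mem (hz2 ▸ aeval_mem_awayIntegers hx _)
  set φ := M * z - aeval x H with hφ
  have hφmem : φ ∈ awayIntegers a :=
    sub_mem (mul_mem (intCast_mem _ _) hzmem) (aeval_mem_awayIntegers hx _)
  have hφ0 : φ ≠ 0 := by
    intro h
    apply hRx
    rw [hRdef, map_sub, map_mul, ← hz2, aeval_C, map_pow (aeval x) H,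
      ← sub_eq_zero.1 h]
    simp
    ring
  have hφE : ∀ p ∈ E, place p φ * place p x ≤ G := fun p hp => by
    refine (abv_approx_sqrt_sub_mul_le (S := S₁) (S' := S₁ ^ 4) (place_intCast_le p)
      (one_le_place_mul_natAbs p) hci hcj hck hM hqi hqj hqk hli hlj hlk
      (hSi.trans hSS₁) (hSj.trans hSS₁) (hSk.trans hSS₁) hH hlH hHS hRdeg hRS (hxE1 p hp)
      (hbig' p hp) hyj hyk (hsign p hp)).trans (le_trans ?_ hG8)
    push_cast
    have : 4 * (S₁ : ℝ) ^ 8 = 4 * S₁ * S₁ ^ 4 * S₁ ^ 3 := by ring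
    rw [this]
    exact le_mul_of_one_le_right (by positivity) hS₁7
  have hφr : ∀ p ∈ places a, p ∉ E → place p φ ≤ G := fun p hp hpE => by
    have hxp := hxr p hp hpE
    have hM' : place p M ≤ S₁ :=
      (place_intCast_le p M).trans (by exact_mod_cast hMS)
    have hP : ∀ {P : ℤ[X]} {n s : ℕ}, P.natDegree ≤ n → n ≤ 2 * e → coeffSum P ≤ s →
        place p (aeval x P) ≤ s * r ^ (2 * e) := fun {P n s} hn hne hs =>
      (abv_aeval_le (place_intCast_le p) (hn.trans hne) hr' hxp).trans
        (mul_le_mul_of_nonneg_right (by exact_mod_cast hs) (by positivity))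
    have hz' : place p z ≤ S * r ^ (2 * e) := by
      refine abs_le_of_sq_le_sq' ?_ (by positivity) |>.2
      rw [← map_pow, hz2, map_mul, map_mul, sq]
      exact mul_le_mul (hP hqj (by omega) hSj) (hP hqk (by omega) hSk)
        (AbsoluteValue.nonneg _ _) (by positivity)
    calc place p φ ≤ place p M * place p z + place p (aeval x H) := by
          rw [← map_mul]; exact AbsoluteValue.sub_le_add _ _ _
      _ ≤ S₁ * (S * r ^ (2 * e)) + S₁ * r ^ (2 * e) :=
        add_le_add (mul_le_mul hM' hz' (AbsoluteValue.nonneg _ _) (by positivity))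
          (hP hH (by omega) hHS)
      _ = (S₁ * (S + 1)) * r ^ (2 * e) := by ring
      _ ≤ G := by
        refine mul_le_mul_of_nonneg_right ?_ (by positivity)
        have hS1 : (S : ℝ) + 1 ≤ S₁ := by
          have := mul_nonneg (sub_nonneg.2 hS') (by positivity : (0 : ℝ) ≤ S)
          linarith
        calc (S₁ : ℝ) * (S + 1) ≤ S₁ * S₁ := by gcongr
          _ ≤ 4 * ((S₁ : ℝ) ^ 3 * S₁ ^ 3) * (S₁ * S₁) := by
            refine le_mul_of_one_le_left (by positivity) ?_
            linarith [one_le_mul_of_one_le_of_one_le hS₁7 hS₁7]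
          _ = _ := by ring
  have hφG : ∀ p ∈ places a, place p φ ≤ G := fun p hp => by
    by_cases hpE : p ∈ E
    · exact (le_mul_of_one_le_right (AbsoluteValue.nonneg _ _) (hxE1 p hpE)).trans (hφE p hpE)
    · exact hφr p hp hpE
  have hprod := one_le_prod_place ha hφmem hφ0
  rw [← Finset.mul_prod_erase _ _ (hE hp₀)] at hprod
  have hrest : ∏ p ∈ (places a).erase p₀, place p φ ≤ G ^ ((places a).card - 1) := by
    rw [← Finset.card_erase_of_mem (hE hp₀), ← Finset.prod_const]
    exact Finset.prod_le_prod (fun _ _ => AbsoluteValue.nonneg _ _)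
      fun p hp => hφG p (Finset.mem_of_mem_erase hp)
  have hBpos : 0 < B := by linarith
  have : B ≤ G ^ (places a).card := by
    calc B = B * 1 := (mul_one B).symm
      _ ≤ B * (place p₀ φ * ∏ p ∈ (places a).erase p₀, place p φ) := by gcongr
      _ ≤ place p₀ x * (place p₀ φ * G ^ ((places a).card - 1)) := by
        have := hxE p₀ hp₀
        gcongr
      _ = place p₀ φ * place p₀ x * G ^ ((places a).card - 1) := by ring
      _ ≤ G * G ^ ((places a).card - 1) := by
        have := hφE p₀ hp₀
        gcongr
      _ = _ := mul_pow_sub_one hcard G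
  linarith

/-- The values at `x` of the polynomials `q i` are in few classes of `ℚˣ` modulo squares. -/
lemma ncard_isSquare_mul_le {a : ℤ} (ha : a ≠ 0) {x : ℚ} (hx : x ∈ awayIntegers a)
    {E : Finset ℕ} (hE : E ⊆ places a) (hEne : E.Nonempty) {S S₁ e r : ℕ} {B : ℝ} (he : 1 ≤ e)
    (hr : 1 ≤ r) (hS : 2 ≤ S) (hS₁ : S₁ = (S ^ 2) ^ 4 ^ (2 * e))
    (hB : (4 * (S₁ : ℝ) ^ 8 * r ^ (2 * e)) ^ (places a).card < B)
    (hxE : ∀ p ∈ E, B ≤ place p x) (hxr : ∀ p ∈ places a, p ∉ E → place p x ≤ r)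
    {ι : Type*} [Finite ι] {q : ι → ℤ[X]} {c : ι → ℤ} {n : ι → ℕ} (hc : ∀ i, c i ≠ 0)
    (hn : ∀ i, n i ≤ e) (hq : ∀ i, (q i).natDegree ≤ 2 * n i)
    (hl : ∀ i, (q i).coeff (2 * n i) = c i ^ 2) (hqS : ∀ i, coeffSum (q i) ≤ S)
    (hcS : ∀ i, (c i).natAbs ≤ S)
    (hns : ∀ i j, i ≠ j → ∀ (M : ℤ) (H : ℤ[X]), M ≠ 0 → C (M ^ 2) * (q i * q j) ≠ H ^ 2) (i : ι) :
    {j | IsSquare (aeval x (q i) * aeval x (q j))}.ncard ≤ 2 ^ (places a).card := by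
  classical
  have hy : ∀ j, ∃ y, IsSquare (aeval x (q i) * aeval x (q j)) →
      y ^ 2 = aeval x (q i) * aeval x (q j) := fun j => by
    by_cases h : IsSquare (aeval x (q i) * aeval x (q j))
    · obtain ⟨y, hy⟩ := h
      exact ⟨y, fun _ => by rw [hy, sq]⟩
    · exact ⟨0, fun h' => (h h').elim⟩
  choose y hy using hy
  rw [← Finset.card_powerset, ← Set.ncard_coe_finset]
  refine Set.ncard_le_ncard_of_injOn (fun j => E.filter fun p =>
    place p (y j / (c i * c j * x ^ (n i + n j)) - 1) ≤
      place p (y j / (c i * c j * x ^ (n i + n j)) + 1)) (fun j _ => ?_) ?_ (Finset.finite_toSet _)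
  · exact Finset.mem_coe.2 (Finset.mem_powerset.2 ((Finset.filter_subset _ _).trans hE))
  · intro j hj k hk hjk
    by_contra hne
    obtain ⟨M, H, hM, h⟩ := square_mul_of_same_signs ha hx hE hEne he hr hS hS₁ hB hxE hxr
      (hc i) (hc j) (hc k) (hn j) (hn k) (hq i) (hq j) (hq k) (hl i) (hl j) (hl k)
      (hqS i) (hqS j) (hqS k) (hcS j) (hcS k) (hy j hj) (hy k hk) fun p hp => by
        have := Finset.ext_iff.1 hjk p
        simpa only [Finset.mem_filter, hp, true_and] using this
    exact hns j k hne M H hM h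

end SquareClasses

lemma even_natDegree_of_derivative_eq {f g : ℤ[X]} {a b : ℤ} (hdeg : f.natDegree ≠ 0) (ha : a ≠ 0)
    (hder : derivative f = g ^ 2 * (C a * X + C b)) : Even f.natDegree := by
  have h1 : (derivative f).natDegree = f.natDegree - 1 :=
    natDegree_eq_of_degree_eq_some (degree_derivative hdeg)
  have hg : g ≠ 0 := by
    rintro rfl
    have h := degree_derivative hdeg
    rw [hder] at h
    simp at h
  have h2 : (g ^ 2 * (C a * X + C b)).natDegree = 2 * g.natDegree + 1 := by
    rw [natDegree_mul (pow_ne_zero 2 hg), natDegree_pow, natDegree_linear ha]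
    intro h
    have := natDegree_linear (b := b) ha
    rw [h, natDegree_zero] at this
    exact zero_ne_one this
  rw [hder, h2] at h1
  exact ⟨g.natDegree + 1, by omega⟩

lemma mul_ne_sq_of_irreducible {F : Type*} [Field F] {P Q : F[X]} (hP : P ≠ 0)
    (hQ : Irreducible Q) (hPQ : P.natDegree < Q.natDegree) (h : F[X]) : P * Q ≠ h ^ 2 := by
  intro heq
  have h1 : Q ∣ h := hQ.prime.dvd_of_dvd_pow (heq ▸ dvd_mul_left Q P)
  have h2 : Q * Q ∣ P * Q := by
    rw [heq, ← sq]
    exact pow_dvd_pow_of_dvd h1 2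
  have h3 : Q ∣ P := (mul_dvd_mul_iff_right hQ.ne_zero).1 h2
  exact absurd (natDegree_le_of_dvd h3 hP) (not_le.2 hPQ)

/-- The iterates of `f` are pairwise inequivalent modulo squares if `f` is dynamically irreducible
modulo some prime. -/
lemma polyIter_mul_polyIter_ne_sq {f : ℤ[X]} (hdeg : 2 ≤ f.natDegree) {p : ℕ} [Fact p.Prime]
    (hpc : ¬ (p : ℤ) ∣ f.leadingCoeff) (hirr : DynIrred (f.map (Int.castRingHom (ZMod p))))
    {i j : ℕ} (hj : 1 ≤ j) (hij : i < j) {c M : ℤ} (hc : ¬ (p : ℤ) ∣ c) (hM : M ≠ 0) (H : ℤ[X]) :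
    C (M ^ 2) * (C c * (polyIter f i * polyIter f j)) ≠ H ^ 2 := by
  intro heq
  set φ := Int.castRingHom (ZMod p) with hφ
  have hφ0 : ∀ n : ℤ, ¬ (p : ℤ) ∣ n → φ n ≠ 0 := fun n hn => by
    rwa [hφ, eq_intCast, Ne, ZMod.intCast_zmod_eq_zero_iff_dvd]
  have hdvd : C M ^ 2 ∣ H ^ 2 := by
    rw [← heq, C_pow]
    exact dvd_mul_right _ _
  obtain ⟨H, rfl⟩ := (UniqueFactorizationMonoid.pow_dvd_pow_iff_dvd two_ne_zero).1 hdvd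
  rw [mul_pow, C_pow] at heq
  replace heq := mul_left_cancel₀ (pow_ne_zero 2 (C_ne_zero.2 hM)) heq
  apply_fun Polynomial.map φ at heq
  rw [Polynomial.map_mul, Polynomial.map_mul, Polynomial.map_pow, polyIter_map, polyIter_map, map_C,
    ← mul_assoc] at heq
  have hd : (f.map φ).natDegree = f.natDegree :=
    natDegree_map_of_leadingCoeff_ne_zero _ (hφ0 _ hpc)
  refine mul_ne_sq_of_irreducible (mul_ne_zero (C_ne_zero.2 (hφ0 c hc))
    (polyIter_ne_zero (by omega) i)) (hirr j hj) ?_ _ heq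
  rw [natDegree_C_mul (hφ0 c hc), natDegree_polyIter, natDegree_polyIter, hd]
  exact Nat.pow_lt_pow_right (by omega) hij

lemma coeffSum_polyIter_le {f : ℤ[X]} {A : ℕ} (hdeg : f.natDegree ≠ 0) (hA : coeffSum f ≤ A)
    (n : ℕ) : coeffSum (polyIter f n) ≤ A ^ (f.natDegree + 1) ^ n := by
  have hA1 : 1 ≤ A := (one_le_coeffSum (by rintro rfl; simp at hdeg)).trans hA
  induction n with
  | zero =>
    rw [polyIter, ← monomial_one_one_eq_X, coeffSum_monomial]
    simpa using hA1
  | succ n ih =>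
    rw [polyIter]
    refine (coeffSum_comp_le _ _ (one_le_coeffSum (polyIter_ne_zero hdeg n))).trans ?_
    calc coeffSum f * coeffSum (polyIter f n) ^ f.natDegree
        ≤ A * (A ^ (f.natDegree + 1) ^ n) ^ f.natDegree := by gcongr
      _ = A ^ (1 + (f.natDegree + 1) ^ n * f.natDegree) := by rw [pow_add, pow_one, pow_mul]
      _ ≤ A ^ ((f.natDegree + 1) ^ (n + 1)) := by
        refine Nat.pow_le_pow_right hA1 ?_
        have := Nat.one_le_pow n (f.natDegree + 1) (by omega)
        rw [pow_succ, mul_add, mul_one]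
        omega

lemma natAbs_eval_scaleRoots_le (P : ℤ[X]) (a b : ℤ) {B n : ℕ} (hB : 1 ≤ B) (ha : a.natAbs ≤ B)
    (hb : b.natAbs ≤ B) (hn : P.natDegree ≤ n) :
    ((P.scaleRoots a).eval b).natAbs ≤ coeffSum P * B ^ n := by
  rw [eval_eq_sum_range, natDegree_scaleRoots, coeffSum_eq_sum_of_subset
    (supp_subset_range (Nat.lt_succ_self _)), Finset.sum_mul]
  refine (Int.natAbs_sum_le _ _).trans (Finset.sum_le_sum fun i hi => ?_)
  rw [coeff_scaleRoots, Int.natAbs_mul, Int.natAbs_mul, Int.natAbs_pow, Int.natAbs_pow, mul_assoc]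
  refine Nat.mul_le_mul_left _ ?_
  have hi' : i ≤ P.natDegree := Nat.lt_succ_iff.1 (Finset.mem_range.1 hi)
  calc _ ≤ B ^ (P.natDegree - i) * B ^ i := by gcongr
    _ = B ^ P.natDegree := by rw [← pow_add, Nat.sub_add_cancel hi']
    _ ≤ B ^ n := Nat.pow_le_pow_right hB hn

lemma natAbs_critInt_le {f : ℤ[X]} (hdeg : f.natDegree ≠ 0) (a b : ℤ) {A : ℕ}
    (hA : coeffSum f ≤ A) (ha : a.natAbs ≤ A) (hb : b.natAbs ≤ A) (n : ℕ) :
    (critInt f a b n).natAbs ≤ A ^ (3 * (f.natDegree + 1) ^ n) := by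
  have hA1 : 1 ≤ A := (one_le_coeffSum (by rintro rfl; simp at hdeg)).trans hA
  have h1 := coeffSum_polyIter_le hdeg hA n
  rw [critInt, Int.natAbs_mul]
  calc _ ≤ A ^ (f.natDegree + 1) ^ n * (A ^ (f.natDegree + 1) ^ n * A ^ (f.natDegree + 1) ^ n) := by
        refine Nat.mul_le_mul ((natAbs_coeff_le_coeffSum _ _).trans h1) ?_
        refine (natAbs_eval_scaleRoots_le (B := A) _ a (-b) hA1 ha
          (by rwa [Int.natAbs_neg]) ?_).trans
          (Nat.mul_le_mul_right _ h1)
        rw [natDegree_polyIter]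
        exact Nat.pow_le_pow_left (Nat.le_succ _) n
    _ = _ := by ring

lemma exists_critInt_eq_mul_sq {f : ℤ[X]} (hdeg : f.natDegree ≠ 0) (heven : Even f.natDegree)
    {a : ℤ} (ha : a ≠ 0) (b : ℤ) (m : ℕ) {k : ℕ} (hk : k ≠ 0) : ∃ s : ℚ, s ≠ 0 ∧
      (critInt f a b (k + m) : ℚ) = aeval (aeval (-(b : ℚ) / a) (polyIter f m))
        (C (polyIter f k).leadingCoeff * polyIter f k) * s ^ 2 := by
  have hf0 : f.leadingCoeff ≠ 0 := leadingCoeff_ne_zero.2 (by rintro rfl; simp at hdeg)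
  have hlc : ((polyIter f m).leadingCoeff : ℚ) ≠ 0 := by
    exact_mod_cast leadingCoeff_ne_zero.2 (polyIter_ne_zero hdeg m)
  have ha' : (a : ℚ) ≠ 0 := by exact_mod_cast ha
  obtain ⟨e, he⟩ := (heven.pow_of_ne_zero hk).two_dvd
  refine ⟨(polyIter f m).leadingCoeff ^ e * a ^ (e * f.natDegree ^ m), by positivity, ?_⟩
  have h := map_critInt (Int.castRingHom ℚ) (f := f) (b := b) (by simpa using ha') (k + m)
  rw [eval_map, leadingCoeff_polyIter_add hdeg] at h
  rw [← eq_intCast (Int.castRingHom ℚ), h, map_mul (aeval _), aeval_C,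
    ← aeval_comp, ← polyIter_add, pow_add, he, aeval_def]
  simp only [eq_intCast, algebraMap_int_eq, Int.cast_mul, Int.cast_pow]
  ring

lemma exists_pow_lt_two_pow_two_pow (A d N r : ℕ) : ∃ D, 2 ≤ D ∧ ∀ K, 1 ≤ K →
    (4 * (((A ^ (2 * (d + 1) ^ K)) ^ 2) ^ 4 ^ (2 * d ^ K)) ^ 8 * r ^ (2 * d ^ K)) ^ N <
      2 ^ 2 ^ D ^ K := by
  set c := N * (2 + 32 * A + 2 * r) with hc
  refine ⟨(c + 5) * (d + 1), by nlinarith, fun K hK => ?_⟩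
  set q := (d + 1) ^ K with hq
  set e := d ^ K with he
  have heq : e ≤ q := Nat.pow_le_pow_left (Nat.le_succ d) K
  have hq1 : 1 ≤ q := Nat.one_le_pow _ _ (Nat.succ_pos d)
  calc (4 * (((A ^ (2 * q)) ^ 2) ^ 4 ^ (2 * e)) ^ 8 * r ^ (2 * e)) ^ N
      ≤ (2 ^ 2 * ((((2 ^ A) ^ (2 * q)) ^ 2) ^ 4 ^ (2 * e)) ^ 8 * (2 ^ r) ^ (2 * e)) ^ N := by
        have hA : A ≤ 2 ^ A := Nat.lt_two_pow_self.le
        have hr : r ≤ 2 ^ r := Nat.lt_two_pow_self.le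
        gcongr
        norm_num
    _ = 2 ^ (N * (2 + 32 * A * (q * 4 ^ (2 * e)) + 2 * r * e)) := by
        simp only [← pow_mul, ← pow_add]
        congr 1
        ring
    _ < _ := by
        refine Nat.pow_lt_pow_right one_lt_two ?_
        have h4 : 1 ≤ 4 ^ (2 * q) := Nat.one_le_pow _ _ (by norm_num)
        calc N * (2 + 32 * A * (q * 4 ^ (2 * e)) + 2 * r * e)
            ≤ N * (2 * (q * 4 ^ (2 * q)) + 32 * A * (q * 4 ^ (2 * q)) +
              2 * r * (q * 4 ^ (2 * q))) := by
              have h5 : 4 ^ (2 * e) ≤ 4 ^ (2 * q) := Nat.pow_le_pow_right (by norm_num) (by omega)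
              have h6 : q * 1 ≤ q * 4 ^ (2 * q) := Nat.mul_le_mul_left q h4
              gcongr <;> omega
          _ = c * (q * 4 ^ (2 * q)) := by rw [hc]; ring
          _ < 2 ^ c * (2 ^ q * 2 ^ (4 * q)) := by
              rw [show 2 ^ (4 * q) = 4 ^ (2 * q) by
                rw [show 4 * q = 2 * (2 * q) by ring, pow_mul]; norm_num]
              have : c < 2 ^ c := Nat.lt_two_pow_self
              have : q < 2 ^ q := Nat.lt_two_pow_self
              gcongr
          _ = 2 ^ (c + (q + 4 * q)) := by rw [pow_add, pow_add]
          _ ≤ _ := by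
              refine Nat.pow_le_pow_right two_pos ?_
              rw [mul_pow]
              calc c + (q + 4 * q) ≤ (c + 5) * q := by nlinarith
                _ ≤ _ := Nat.mul_le_mul_right q (Nat.le_self_pow (by omega) _)

lemma pow_three_mul_pow_le (A d n₀ : ℕ) {D : ℕ} (hD : 2 ≤ D) : ∃ s, ∀ K, 1 ≤ K →
    ∀ n, n ≤ n₀ + D ^ K + K → A ^ (3 * (d + 1) ^ n) ≤ 2 ^ 2 ^ s ^ K := by
  refine ⟨(3 * A + (d + 1) * (n₀ + 2)) * D, fun K hK n hn => ?_⟩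
  have hKD : K ≤ D ^ K := Nat.lt_two_pow_self.le.trans (Nat.pow_le_pow_left hD K)
  have hD1 : 1 ≤ D ^ K := Nat.one_le_pow _ _ (by omega)
  calc A ^ (3 * (d + 1) ^ n) ≤ (2 ^ A) ^ (3 * (d + 1) ^ n) :=
        Nat.pow_le_pow_left Nat.lt_two_pow_self.le _
    _ = 2 ^ (3 * A * (d + 1) ^ n) := by rw [← pow_mul]; congr 1; ring
    _ ≤ _ := by
      refine Nat.pow_le_pow_right two_pos ?_
      calc 3 * A * (d + 1) ^ n ≤ 2 ^ (3 * A) * (2 ^ (d + 1)) ^ n :=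
            Nat.mul_le_mul Nat.lt_two_pow_self.le (Nat.pow_le_pow_left Nat.lt_two_pow_self.le n)
        _ = 2 ^ (3 * A + (d + 1) * n) := by rw [← pow_mul, ← pow_add]
        _ ≤ _ := by
          refine Nat.pow_le_pow_right two_pos ?_
          have h1 : n ≤ (n₀ + 2) * D ^ K := by nlinarith
          rw [mul_pow]
          calc 3 * A + (d + 1) * n ≤ 3 * A * D ^ K + (d + 1) * ((n₀ + 2) * D ^ K) := by
                have := Nat.le_mul_of_pos_right (3 * A) hD1
                gcongr
            _ = (3 * A + (d + 1) * (n₀ + 2)) * D ^ K := by ring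
            _ ≤ _ := Nat.mul_le_mul_right _ (Nat.le_self_pow (by omega) _)

/-- There are many integers of moderate size, in few classes modulo squares, that are non-residues
modulo every large prime modulo which `f` is dynamically irreducible. -/
lemma exists_nonresidues {f g : ℤ[X]} {a b : ℤ} (hdeg : 2 ≤ f.natDegree)
    (hder : derivative f = g ^ 2 * (C a * X + C b)) (ha : a ≠ 0)
    (hγ : ¬ IsPreperiodicPt f (-(b : ℚ) / (a : ℚ))) : ∃ T D₀ s : ℕ, ∀ K, 1 ≤ K →
      ∃ w : Fin K → ℤ, (∀ i, (w i).natAbs ≤ 2 ^ 2 ^ s ^ K) ∧ ∀ p : ℕ, p.Prime → D₀ < p →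
        DynIrred (f.map (Int.castRingHom (ZMod p))) →
          (∀ i, J(w i | p) = -1) ∧ ∀ i, {j | IsSquare (w i * w j)}.ncard ≤ T := by
  have hdeg0 : f.natDegree ≠ 0 := by omega
  have heven := even_natDegree_of_derivative_eq hdeg0 ha hder
  have hf0 : f.leadingCoeff ≠ 0 := leadingCoeff_ne_zero.2 (by rintro rfl; simp at hdeg0)
  obtain ⟨E, n₀, r, hE, hEne, hr, hEbig, hEsmall⟩ := exists_escaping_places hdeg ha hγ
  set d := f.natDegree with hd
  set A := coeffSum f + a.natAbs + b.natAbs + 2 with hA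
  obtain ⟨D, hD, hDK⟩ := exists_pow_lt_two_pow_two_pow A d (places a).card r
  obtain ⟨s, hs⟩ := pow_three_mul_pow_le A d n₀ hD
  refine ⟨2 ^ (places a).card, a.natAbs + f.leadingCoeff.natAbs + 2, s, fun K hK => ?_⟩
  set m := n₀ + D ^ K with hm
  have hD1 : 1 ≤ D ^ K := Nat.one_le_pow _ _ (by omega)
  refine ⟨fun i => critInt f a b (i + 1 + m), fun i => ?_, fun p hp hpD hirr => ⟨fun i => ?_, ?_⟩⟩
  · exact (natAbs_critInt_le hdeg0 a b (by omega) (by omega) (by omega) _).trans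
      (hs K hK _ (by omega))
  · refine jacobiSym_critInt_eq_neg_one hdeg0 heven hder hp (by omega) (fun h => ?_) (fun h => ?_)
      hirr (by omega)
    · have := Nat.le_of_dvd (Int.natAbs_pos.2 ha) (Int.natCast_dvd.1 h)
      omega
    · have := Nat.le_of_dvd (Int.natAbs_pos.2 hf0) (Int.natCast_dvd.1 h)
      omega
  · intro i
    have := Fact.mk hp
    have hpc : ¬ (p : ℤ) ∣ f.leadingCoeff := fun h => by
      have := Nat.le_of_dvd (Int.natAbs_pos.2 hf0) (Int.natCast_dvd.1 h)
      omega
    set x := aeval (-(b : ℚ) / a) (polyIter f m) with hx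
    set c : Fin K → ℤ := fun i => (polyIter f (i + 1)).leadingCoeff with hc
    set q : Fin K → ℤ[X] := fun i => C (c i) * polyIter f (i + 1) with hq
    have hc0 : ∀ i, c i ≠ 0 := fun i => leadingCoeff_ne_zero.2 (polyIter_ne_zero hdeg0 _)
    have hpc' : ∀ i, ¬ (p : ℤ) ∣ c i := fun i => by
      have h := map_leadingCoeff_polyIter_ne_zero (Int.castRingHom (ZMod p)) hdeg0
        (by rwa [eq_intCast, Ne, ZMod.intCast_zmod_eq_zero_iff_dvd]) (i + 1)
      rwa [eq_intCast, Ne, ZMod.intCast_zmod_eq_zero_iff_dvd] at h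
    have htwo : ∀ i : Fin K, 2 * (d ^ ((i : ℕ) + 1) / 2) = d ^ ((i : ℕ) + 1) := fun i =>
      Nat.two_mul_div_two_of_even (heven.pow_of_ne_zero (by omega))
    have hmono : ∀ i : Fin K, coeffSum (polyIter f (i + 1)) ≤ A ^ (d + 1) ^ K := fun i =>
      (coeffSum_polyIter_le hdeg0 (by omega) _).trans
        (Nat.pow_le_pow_right (by omega) (Nat.pow_le_pow_right (by omega) (by omega)))
    have hcA : ∀ i, (c i).natAbs ≤ A ^ (d + 1) ^ K := fun i =>
      (natAbs_coeff_le_coeffSum _ _).trans (hmono i)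
    have hsq : A ^ (2 * (d + 1) ^ K) = A ^ (d + 1) ^ K * A ^ (d + 1) ^ K := by
      rw [two_mul, pow_add]
    have hA1 : 2 ≤ A ^ (d + 1) ^ K :=
      (by omega : 2 ≤ A).trans (Nat.le_self_pow (by positivity) _)
    refine le_trans (Set.ncard_le_ncard (fun j hj => ?_) (Set.toFinite _))
      (ncard_isSquare_mul_le ha (x := x) (S := A ^ (2 * (d + 1) ^ K)) (e := d ^ K) (r := r)
      (B := 2 ^ 2 ^ D ^ K) (q := q) (c := c) (n := fun i => d ^ ((i : ℕ) + 1) / 2)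
      (aeval_mem_awayIntegers (neg_div_mem_awayIntegers a b) _) hE hEne
      (Nat.one_le_pow _ _ (by omega)) hr (by rw [hsq]; nlinarith) rfl (by exact_mod_cast hDK K hK)
      (fun p hp => hEbig p hp _) (fun p hp hpE => hEsmall p hp hpE _) hc0 (fun i => ?_)
      (fun i => ?_) (fun i => ?_) (fun i => ?_) (fun i => ?_) (fun i j hij M H hM => ?_) i)
    · obtain ⟨si, hsi, hi⟩ := exists_critInt_eq_mul_sq hdeg0 heven ha b m (k := i + 1) (by omega)
      obtain ⟨sj, hsj, hj'⟩ := exists_critInt_eq_mul_sq hdeg0 heven ha b m (k := j + 1) (by omega)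
      obtain ⟨z, hz⟩ := hj
      refine ⟨z / (si * sj), ?_⟩
      have hz' :
          ((critInt f a b (i + 1 + m) : ℤ) : ℚ) * (critInt f a b (j + 1 + m) : ℤ) = z * z := by
        exact_mod_cast hz
      rw [hi, hj'] at hz'
      simp only [hq, hc]
      field_simp
      linear_combination hz'
    · exact (Nat.div_le_self _ _).trans (Nat.pow_le_pow_right (by omega) (by omega))
    · rw [htwo]
      exact (natDegree_C_mul_le _ _).trans (natDegree_polyIter f _).le
    · rw [htwo, coeff_C_mul, sq, ← natDegree_polyIter f]
      rfl
    · rw [hsq]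
      refine (coeffSum_mul_le _ _).trans (Nat.mul_le_mul ?_ (hmono i))
      rw [coeffSum_C]
      exact hcA i
    · rw [hsq]
      exact (hcA i).trans (Nat.le_mul_of_pos_right _ (by omega))
    · have hprod : q i * q j = C (c i * c j) * (polyIter f (i + 1) * polyIter f (j + 1)) := by
        simp only [hq, C_mul]
        ring
      have hcc : ¬ (p : ℤ) ∣ c i * c j :=
        (Nat.prime_iff_prime_int.1 hp).not_dvd_mul (hpc' i) (hpc' j)
      rw [hprod]
      rcases lt_or_gt_of_ne hij with h | h
      · exact polyIter_mul_polyIter_ne_sq hdeg hpc hirr (by omega) (by simpa using h) hcc hM H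
      · rw [mul_comm (polyIter f (i + 1))]
        exact polyIter_mul_polyIter_ne_sq hdeg hpc hirr (by omega) (by simpa using h) hcc hM H

lemma two_pow_two_pow_le_exp {s K : ℕ} {L : ℝ} (hy : 6 ≤ Real.log L) (hL : 0 < L)
    (hK : K * (2 * Real.log (s + 2)) ≤ Real.log (Real.log L)) :
    ((2 ^ 2 ^ s ^ K : ℕ) : ℝ) ≤ Real.exp (L / 8) := by
  have htwo : ∀ n : ℕ, (2 : ℝ) ^ n ≤ Real.exp n := fun n => by
    rw [← Real.exp_one_pow]
    exact pow_le_pow_left₀ zero_le_two (by linarith [Real.add_one_le_exp 1]) n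
  set y := Real.log L with hydef
  set Y := Real.exp (Real.log y / 2) with hY
  have hY2 : Y ^ 2 = y := by
    rw [hY, ← Real.exp_nat_mul, Nat.cast_ofNat, mul_div_cancel₀ _ two_ne_zero,
      Real.exp_log (by linarith)]
  have hY0 : 0 < Y := Real.exp_pos _
  have hsY : ((s ^ K : ℕ) : ℝ) ≤ Y := by
    calc ((s ^ K : ℕ) : ℝ) ≤ ((s : ℝ) + 2) ^ K := by
          push_cast
          gcongr
          linarith
      _ = Real.exp (K * Real.log (s + 2)) := by
          rw [Real.exp_nat_mul, Real.exp_log (by positivity)]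
      _ ≤ Y := Real.exp_le_exp.2 (by linarith)
  have hY2' : 2 ≤ Y := by nlinarith
  have h8 : Real.exp Y ≤ L / 8 := by
    have h1 : Real.exp Y * Real.exp 3 ≤ L := by
      rw [← Real.exp_add, ← Real.exp_log hL]
      exact Real.exp_le_exp.2 (by nlinarith)
    have h2 := htwo 3
    norm_num at h2
    nlinarith [Real.exp_pos Y]
  push_cast
  refine (htwo _).trans (Real.exp_le_exp.2 (le_trans ?_ h8))
  push_cast
  exact (htwo _).trans (Real.exp_le_exp.2 hsY)

lemma le_mul_div_log_mul_log {P Q L w T κ K z W : ℝ} (hQ : 1 ≤ Q) (hL : L = Real.log Q)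
    (hL400 : 400 ≤ L) (hκ : 0 < κ) (hwκ : 2 * κ ≤ w) (hwL : w ≤ L) (hT : 0 ≤ T)
    (hK : w / κ - 1 ≤ K) (hz : Real.exp (L / 16) - 1 ≤ z) (hz' : z ≤ Real.exp (L / 16))
    (hW0 : 0 ≤ W) (hW : W ≤ Real.exp (L / 8))
    (h : K ^ 2 * P ≤ K * T * (2 * (Q + 1) / Real.log z + z ^ 4) + K ^ 2 * (z ^ 4 * (8 * W ^ 2))) :
    P ≤ (258 * T * κ + 1) * Q / (L * w) := by
  have hexpL : Real.exp L = Q := by rw [hL, Real.exp_log (by linarith)]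
  have hw : 0 < w := by linarith
  have hKw : w / (2 * κ) ≤ K := by
    refine le_trans ?_ hK
    have h1 : w / κ = w / (2 * κ) + w / (2 * κ) := by field_simp; ring
    have h2 : 1 ≤ w / (2 * κ) := (one_le_div (by positivity)).2 hwκ
    linarith
  have hK0 : 0 < K := lt_of_lt_of_le (by positivity) hKw
  set u := Real.exp (L / 32) with hu
  have hu2 : 2 ≤ u := by
    have := Real.add_one_le_exp (L / 32)
    linarith
  have huu : Real.exp (L / 16) = u ^ 2 := by
    rw [hu, ← Real.exp_nat_mul]
    congr 1
    push_cast
    ring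
  have hzu : u ≤ z := by nlinarith
  have hlogz : L / 32 ≤ Real.log z := by
    rw [Real.le_log_iff_exp_le (by linarith)]
    exact hzu
  have hz0 : 0 < z := by linarith
  have hz4 : z ^ 4 ≤ Real.exp (L / 4) := by
    refine (pow_le_pow_left₀ hz0.le hz' 4).trans_eq ?_
    rw [← Real.exp_nat_mul]
    congr 1
    push_cast
    ring
  have hW2 : W ^ 2 ≤ Real.exp (L / 4) := by
    refine (pow_le_pow_left₀ hW0 hW 2).trans_eq ?_
    rw [← Real.exp_nat_mul]
    congr 1
    push_cast
    ring
  have hL0 : 0 < L := by linarith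
  have h1 : 2 * (Q + 1) / Real.log z ≤ 128 * (Q / L) := by
    calc 2 * (Q + 1) / Real.log z ≤ 4 * Q / (L / 32) :=
          div_le_div₀ (by linarith) (by linarith) (by linarith) hlogz
      _ = _ := by field_simp; ring
  have hLhalf : 8 * L ^ 2 ≤ Real.exp (L / 2) := by
    have := Real.pow_div_factorial_le_exp (L / 2) (by linarith) 3
    refine le_trans ?_ this
    norm_num [Nat.factorial]
    nlinarith [pow_pos hL0 2]
  have hexp : Real.exp (L / 4) ≤ Real.exp (L / 2) := Real.exp_le_exp.2 (by linarith)
  have hhalf : Real.exp (L / 2) * Real.exp (L / 2) = Q := by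
    rw [← Real.exp_add, add_halves, hexpL]
  have h2 : z ^ 4 ≤ Q / L := by
    rw [le_div_iff₀ hL0, ← hhalf]
    refine mul_le_mul (hz4.trans hexp) (le_trans ?_ hLhalf) hL0.le (Real.exp_pos _).le
    nlinarith
  have h3 : z ^ 4 * (8 * W ^ 2) ≤ Q / (L * w) := by
    rw [le_div_iff₀ (by positivity), ← hhalf]
    calc z ^ 4 * (8 * W ^ 2) * (L * w)
        ≤ Real.exp (L / 4) * (8 * Real.exp (L / 4)) * (L * L) := by gcongr
      _ = (Real.exp (L / 4) * Real.exp (L / 4)) * (8 * L ^ 2) := by ring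
      _ = Real.exp (L / 2) * (8 * L ^ 2) := by
        rw [← Real.exp_add]
        congr 2
        ring
      _ ≤ _ := by gcongr
  have h4 : K ^ 2 * P ≤ K ^ 2 * (T * (129 * (Q / L)) / K + Q / (L * w)) := by
    calc K ^ 2 * P ≤ K * T * (128 * (Q / L) + Q / L) + K ^ 2 * (Q / (L * w)) := by
          refine h.trans ?_
          gcongr
      _ = _ := by field_simp; ring
  have h5 := le_of_mul_le_mul_left h4 (by positivity)
  calc P ≤ T * (129 * (Q / L)) / K + Q / (L * w) := h5
    _ ≤ T * (129 * (Q / L)) / (w / (2 * κ)) + Q / (L * w) := by gcongr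
    _ = _ := by field_simp; ring

theorem frequency_P1 (f g : ℤ[X]) (a b : ℤ)
    (hdeg : 2 ≤ f.natDegree)
    (hder : derivative f = g ^ 2 * (C a * X + C b))
    (ha : a ≠ 0)
    (hγ : ¬ IsPreperiodicPt f (-(b : ℚ) / (a : ℚ))) :
    ∃ C : ℝ, 0 < C ∧ ∃ Q₀ : ℕ, ∀ Q : ℕ, Q₀ ≤ Q →
      (Pf f Q : ℝ) ≤ C * Q / (Real.log Q * Real.log (Real.log (Real.log Q))) := by
  obtain ⟨T, D₀, s, hT⟩ := exists_nonresidues hdeg hder ha hγ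
  set κ : ℝ := 2 * Real.log (s + 2) with hκ
  have hκ0 : 0 < κ := by
    have : 0 < Real.log ((s : ℝ) + 2) := Real.log_pos (by linarith [(s.cast_nonneg : (0 : ℝ) ≤ s)])
    positivity
  have hlim := Real.tendsto_log_atTop.comp (tendsto_natCast_atTop_atTop (R := ℝ))
  have hlim2 := Real.tendsto_log_atTop.comp hlim
  have hlim3 := Real.tendsto_log_atTop.comp hlim2
  refine ⟨258 * T * κ + 1, by positivity, Filter.eventually_atTop.1 ?_⟩
  filter_upwards [hlim.eventually_ge_atTop 400, hlim2.eventually_ge_atTop 6,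
    hlim3.eventually_ge_atTop (2 * κ), Filter.eventually_gt_atTop D₀,
    Filter.eventually_ge_atTop 1] with Q hL hy hw hQD hQ1
  simp only [Function.comp_apply] at hL hy hw
  set L := Real.log Q with hLdef
  set w := Real.log (Real.log L) with hwdef
  have hwL : w ≤ L := (Real.log_le_self (by linarith)).trans (Real.log_le_self (by linarith))
  have hw0 : 0 < w := by linarith
  set A := {p : ℕ | p.Prime ∧ Q ≤ p ∧ p ≤ 2 * Q ∧
    DynIrred (f.map (Int.castRingHom (ZMod p)))} with hA
  have hAfin : A.Finite := (Set.finite_Icc Q (2 * Q)).subset fun p hp => ⟨hp.2.1, hp.2.2.1⟩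
  have hPf : Pf f Q = hAfin.toFinset.card := Set.ncard_eq_toFinset_card A hAfin
  rcases A.eq_empty_or_nonempty with hempty | ⟨p₀, hp₀⟩
  · have : Pf f Q = 0 := by
      change A.ncard = 0
      rw [hempty, Set.ncard_empty]
    rw [this, Nat.cast_zero]
    positivity
  set K := ⌊w / κ⌋₊ with hK
  have hwκ : 2 ≤ w / κ := (le_div_iff₀ hκ0).2 hw
  have hK1 : 1 ≤ K := Nat.le_floor (by push_cast; linarith)
  have hKle : (K : ℝ) ≤ w / κ := Nat.floor_le (by linarith)
  obtain ⟨v, hvW, hv⟩ := hT K hK1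
  set z := ⌊Real.exp (L / 16)⌋₊ with hz
  have hzle : (z : ℝ) ≤ Real.exp (L / 16) := Nat.floor_le (Real.exp_pos _).le
  have hz2 : 2 ≤ z := Nat.le_floor (by
    have := Real.add_one_le_exp (L / 16)
    push_cast
    linarith)
  have hQ : (1 : ℝ) ≤ Q := by exact_mod_cast hQ1
  have hzQ : z < Q := by
    have : (z : ℝ) < Q := by
      refine hzle.trans_lt ?_
      rw [← Real.exp_log (show (0 : ℝ) < Q by linarith)]
      exact Real.exp_lt_exp.2 (by linarith)
    exact_mod_cast this
  have hmain := sq_mul_card_primes_le hQ1 hz2 v (hv p₀ hp₀.1 (hQD.trans_le hp₀.2.1) hp₀.2.2.2).2 hvW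
    hAfin.toFinset fun p hp => by
      obtain ⟨hp1, hp2, hp3, hp4⟩ := hAfin.mem_toFinset.1 hp
      exact ⟨hp1, hzQ.trans_le hp2, hp2, hp3, (hv p hp1 (hQD.trans_le hp2) hp4).1⟩
  rw [hPf]
  exact le_mul_div_log_mul_log hQ hLdef hL hκ0 hw hwL (Nat.cast_nonneg T)
    (Nat.sub_one_lt_floor _).le (Nat.sub_one_lt_floor _).le hzle (Nat.cast_nonneg _)
    (two_pow_two_pow_le_exp hy (by linarith) ((le_div_iff₀ hκ0).1 hKle)) hmain
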